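/- arXiv:1906.10866 — 6 statements merged into one kernel-verified Lean document; each statement's English description precedes it below -/
import Mathlib

section
/- Let 0 ≤ δ ≤ 1/20 and let Ω : 𝕊 → 𝕊 be a continuous map which is bi-Lipschitz with constant 1+δ with respect to d_𝕊. Then there exists a continuous function ω : ℝ → ℝ such that Ω(e^{it}) = e^{iω(t)} for every t ∈ ℝ, and for all s, t ∈ ℝ with |t−s| ≤ π one has (1+δ)⁻¹ |t−s| ≤ |ω(t)−ω(s)| ≤ (1+δ) |t−s|. -/
open MeasureTheory Metric Complex Filter Set
open scoped Topology ENNReal NNReal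

noncomputable section

/-- The real inner product on `ℂ ≅ ℝ²`. -/
def rinner (u v : ℂ) : ℝ := u.re * v.re + u.im * v.im

/-- The geodesic distance on the unit circle `𝕊 ⊂ ℂ`. -/
def dS (u v : ℂ) : ℝ := Real.arccos (rinner u v)

/-- The kernel `K(x) = |x| Ω(x/|x|)` (with `K 0 = 0`). -/
def Kmap (Ω : ℂ → ℂ) (x : ℂ) : ℂ := (‖x‖ : ℂ) * Ω (x / (‖x‖ : ℂ))

/-- The support of a measure on `ℂ`. -/
def spt (μ : Measure ℂ) : Set ℂ := {x : ℂ | ∀ r : ℝ, 0 < r → 0 < μ (ball x r)}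

/-- Ahlfors 1-regularity with constant `C₀`. -/
def Ahlfors1 (μ : Measure ℂ) (C₀ : ℝ) : Prop :=
  ∀ x ∈ spt μ, ∀ r : ℝ, 0 < r →
    ENNReal.ofReal (C₀⁻¹ * r) ≤ μ (ball x r) ∧ μ (ball x r) ≤ ENNReal.ofReal (C₀ * r)

/-- `Ω`-symmetry of a measure. -/
def OmegaSym (Ω : ℂ → ℂ) (μ : Measure ℂ) : Prop :=
  ∀ x ∈ spt μ, ∀ r : ℝ, 0 < r → (∫ y in ball x r, Kmap Ω (x - y) ∂μ) = 0

/-- `Ω` maps the unit circle to itself. -/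
def MapsCircle (Ω : ℂ → ℂ) : Prop := ∀ u : ℂ, ‖u‖ = 1 → ‖Ω u‖ = 1

/-- `Ω` is odd on the unit circle. -/
def OddOnCircle (Ω : ℂ → ℂ) : Prop := ∀ u : ℂ, ‖u‖ = 1 → Ω (-u) = -(Ω u)

/-- `Ω` is bi-Lipschitz with constant `1 + δ` on the circle, w.r.t. geodesic distance. -/
def BiLipOnCircle (Ω : ℂ → ℂ) (δ : ℝ) : Prop :=
  ∀ u v : ℂ, ‖u‖ = 1 → ‖v‖ = 1 →
    (1 + δ)⁻¹ * dS u v ≤ dS (Ω u) (Ω v) ∧ dS (Ω u) (Ω v) ≤ (1 + δ) * dS u v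

/-- `Ω` is `C^k` as a circle map: it has a `C^k` lift `ω`. -/
def CircleCk (Ω : ℂ → ℂ) (k : ℕ) : Prop :=
  ∃ ω : ℝ → ℝ, ContDiff ℝ k ω ∧
    ∀ t : ℝ, Ω (Complex.exp ((t : ℂ) * Complex.I)) = Complex.exp ((ω t : ℂ) * Complex.I)

/-- Affine lines in `ℂ`. -/
def IsLine (L : Set ℂ) : Prop :=
  ∃ a b : ℂ, b ≠ 0 ∧ L = {z : ℂ | ∃ t : ℝ, z = a + t • b}

/-- Geodesic distance between two points given by angles. -/
lemma dS_exp (a b : ℝ) :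
    dS (Complex.exp ((a : ℂ) * Complex.I)) (Complex.exp ((b : ℂ) * Complex.I))
      = Real.arccos (Real.cos |b - a|) := by
  unfold dS rinner
  congr 1
  rw [Real.cos_abs, Real.cos_sub, Complex.exp_ofReal_mul_I_re, Complex.exp_ofReal_mul_I_re,
    Complex.exp_ofReal_mul_I_im, Complex.exp_ofReal_mul_I_im]
  ring

lemma dS_exp_eq (a b : ℝ) (h : |b - a| ≤ Real.pi) :
    dS (Complex.exp ((a : ℂ) * Complex.I)) (Complex.exp ((b : ℂ) * Complex.I)) = |b - a| := by
  rw [dS_exp, Real.arccos_cos (abs_nonneg _) h]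

lemma dS_exp_le (a b : ℝ) :
    dS (Complex.exp ((a : ℂ) * Complex.I)) (Complex.exp ((b : ℂ) * Complex.I)) ≤ |b - a| := by
  rcases le_total |b - a| Real.pi with h | h
  · exact (dS_exp_eq a b h).le
  · rw [dS_exp]
    exact (Real.arccos_le_pi _).trans h

/-- Existence of a continuous lift. -/
lemma exists_lift (Ω : ℂ → ℂ) (hmap : MapsCircle Ω)
    (hcont : ContinuousOn Ω (sphere (0 : ℂ) 1)) :
    ∃ ω : ℝ → ℝ, Continuous ω ∧
      ∀ t : ℝ, Ω (Complex.exp ((t : ℂ) * Complex.I)) = Complex.exp ((ω t : ℂ) * Complex.I) := by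
  have hnorm : ∀ t : ℝ, ‖Complex.exp ((t : ℂ) * Complex.I)‖ = 1 :=
    fun t => Complex.norm_exp_ofReal_mul_I t
  have hc : Continuous fun t : ℝ => Ω (Complex.exp ((t : ℂ) * Complex.I)) := by
    refine hcont.comp_continuous (by fun_prop) (fun t => ?_)
    simp
  have hmem : ∀ t : ℝ, Ω (Complex.exp ((t : ℂ) * Complex.I)) ∈ Submonoid.unitSphere ℂ :=
    fun t => mem_sphere_zero_iff_norm.2 (hmap _ (hnorm t))
  let f : C(ℝ, Circle) := ⟨fun t => ⟨Ω (Complex.exp ((t : ℂ) * Complex.I)), hmem t⟩,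
    hc.subtype_mk hmem⟩
  obtain ⟨e₀, he⟩ := Circle.exp_surjective (f 0)
  obtain ⟨F, ⟨-, hF⟩, -⟩ := Circle.isCoveringMap_exp.existsUnique_continuousMap_lifts f 0 e₀ he
  refine ⟨F, F.continuous, fun t => ?_⟩
  have h := congrArg (fun z : Circle => (z : ℂ)) (congrFun hF t)
  exact h.symm

/-- A continuous bi-Lipschitz circle map with constant `1+δ` admits a
continuous lift `ω` with `Ω(e^{it}) = e^{iω(t)}` which is bi-Lipschitz with the same
constant for `|t-s| ≤ π`. -/
theorem stmt_2 (δ : ℝ) (hδ0 : 0 ≤ δ) (hδ1 : δ ≤ 1 / 20)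
    (Ω : ℂ → ℂ) (hmap : MapsCircle Ω)
    (hcont : ContinuousOn Ω (sphere (0 : ℂ) 1))
    (hbilip : BiLipOnCircle Ω δ) :
    ∃ ω : ℝ → ℝ, Continuous ω ∧
      (∀ t : ℝ, Ω (Complex.exp ((t : ℂ) * Complex.I)) = Complex.exp ((ω t : ℂ) * Complex.I)) ∧
      ∀ s t : ℝ, |t - s| ≤ Real.pi →
        (1 + δ)⁻¹ * |t - s| ≤ |ω t - ω s| ∧ |ω t - ω s| ≤ (1 + δ) * |t - s| := by
  obtain ⟨ω, hω, hlift⟩ := exists_lift Ω hmap hcont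
  have hpi := Real.pi_pos
  have hnorm : ∀ t : ℝ, ‖Complex.exp ((t : ℂ) * Complex.I)‖ = 1 :=
    fun t => Complex.norm_exp_ofReal_mul_I t
  -- the upper bound as long as the lifted distance is at most `π`
  have key : ∀ s t : ℝ, |t - s| ≤ Real.pi → |ω t - ω s| ≤ Real.pi →
      |ω t - ω s| ≤ (1 + δ) * |t - s| := by
    intro s t h1 h2
    have h := (hbilip _ _ (hnorm s) (hnorm t)).2
    rwa [hlift, hlift, dS_exp_eq _ _ h1, dS_exp_eq _ _ h2] at h
  -- the upper bound at scale `π / 2`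
  have half : ∀ s t : ℝ, |t - s| ≤ Real.pi / 2 → |ω t - ω s| ≤ (1 + δ) * |t - s| := by
    intro s t h1
    rcases le_total |ω t - ω s| Real.pi with h | h
    · exact key s t (by linarith) h
    · exfalso
      have hcD : ContinuousOn (fun x => |ω x - ω s|) (uIcc s t) := by fun_prop
      have hmem : Real.pi ∈ uIcc |ω s - ω s| |ω t - ω s| := by
        rw [sub_self, abs_zero]
        exact mem_uIcc_of_le hpi.le h
      obtain ⟨x, hx, hxe⟩ := intermediate_value_uIcc hcD hmem
      have hxs : |x - s| ≤ |t - s| := abs_sub_left_of_mem_uIcc hx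
      have hk := key s x (by linarith) hxe.le
      simp only at hxe
      rw [hxe] at hk
      have : (1 + δ) * |x - s| ≤ (1 + 1 / 20) * (Real.pi / 2) :=
        mul_le_mul (by linarith) (by linarith) (abs_nonneg _) (by norm_num)
      linarith
  refine ⟨ω, hω, hlift, fun s t hst => ⟨?_, ?_⟩⟩
  · have h := (hbilip _ _ (hnorm s) (hnorm t)).1
    rw [hlift, hlift, dS_exp_eq _ _ hst] at h
    exact h.trans (dS_exp_le _ _)
  · have e1 : |(s + t) / 2 - s| = |t - s| / 2 := by
      rw [show (s + t) / 2 - s = (t - s) / 2 by ring, abs_div, abs_two]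
    have e2 : |t - (s + t) / 2| = |t - s| / 2 := by
      rw [show t - (s + t) / 2 = (t - s) / 2 by ring, abs_div, abs_two]
    have h1 := half s ((s + t) / 2) (by rw [e1]; linarith)
    have h2 := half ((s + t) / 2) t (by rw [e2]; linarith)
    rw [e1] at h1
    rw [e2] at h2
    have h3 := abs_sub_le (ω t) (ω ((s + t) / 2)) (ω s)
    linarith
end
end

section
/- Let e ∈ 𝕊, let L = ℝe, and let ν be a unit normal to the line K(L) = ℝΩ(e), i.e. ν = iΩ(e) or ν = −iΩ(e). Then for every y ∈ ℂ∖{0}, writing ŷ = y/|y|: if |⟨ŷ, i e⟩| ≤ 1/10 then |⟨Ω(ŷ), ν⟩| ≤ 1/5; and if |⟨ŷ, e⟩| ≤ 1/10 then |⟨Ω(ŷ), Ω(e)⟩| ≤ 1/5. -/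
open MeasureTheory Metric Complex Filter Set
open scoped Topology ENNReal NNReal

noncomputable section

theorem aux_arcsin {a : ℝ} (h : a ≤ 1 / 10) : Real.arcsin a ≤ 101 / 1000 := by
  have h1 : a ≤ Real.sin (101 / 1000) := by
    have := Real.sin_gt_sub_cube (x := 101 / 1000) (by norm_num)
    norm_num at this ⊢
    linarith
  calc Real.arcsin a ≤ Real.arcsin (Real.sin (101 / 1000)) := Real.monotone_arcsin h1
    _ = 101 / 1000 := Real.arcsin_sin (by linarith [Real.pi_gt_three]) (by linarith [Real.pi_gt_three])

theorem aux_unit {u : ℂ} (h : ‖u‖ = 1) : u.re ^ 2 + u.im ^ 2 = 1 := by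
  have := Complex.sq_norm u
  rw [h, Complex.normSq_apply] at this
  nlinarith

theorem aux_sq {u v : ℂ} (hu : ‖u‖ = 1) (hv : ‖v‖ = 1) :
    rinner u v ^ 2 + rinner u (Complex.I * v) ^ 2 = 1 := by
  have h1 := aux_unit hu
  have h2 := aux_unit hv
  simp only [rinner, Complex.mul_re, Complex.mul_im, Complex.I_re, Complex.I_im]
  linear_combination (v.re ^ 2 + v.im ^ 2) * h1 + h2

theorem aux_cos {u v : ℂ} (hu : ‖u‖ = 1) (hv : ‖v‖ = 1) :
    Real.cos (dS u v) = rinner u v := by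
  have := aux_sq hu hv
  exact Real.cos_arccos (by nlinarith [sq_nonneg (rinner u (Complex.I * v))])
    (by nlinarith [sq_nonneg (rinner u (Complex.I * v))])

theorem aux_rneg (u v : ℂ) : rinner (-u) v = - rinner u v := by
  simp [rinner]; ring

theorem aux_dS_neg (u v : ℂ) : dS (-u) v = Real.pi - dS u v := by
  rw [dS, aux_rneg, Real.arccos_neg, dS]

theorem aux_part1 {δ : ℝ} (hδ1 : δ ≤ 1 / 20)
    {Ω : ℂ → ℂ} (hmap : MapsCircle Ω) (hbilip : BiLipOnCircle Ω δ)
    {e : ℂ} (he : ‖e‖ = 1) {u : ℂ} (hu : ‖u‖ = 1) (h0 : 0 ≤ rinner u e)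
    (h : |rinner u (Complex.I * e)| ≤ 1 / 10) :
    |rinner (Ω u) (Complex.I * Ω e)| ≤ 1 / 5 := by
  have h1 := aux_sq hu he
  have hs : dS u e ≤ 101 / 1000 := by
    rw [dS, Real.arccos_eq_arcsin h0]
    apply aux_arcsin
    rw [show 1 - rinner u e ^ 2 = rinner u (Complex.I * e) ^ 2 by linarith, Real.sqrt_sq_eq_abs]
    exact h
  have hn : 0 ≤ dS u e := Real.arccos_nonneg _
  have hn' : 0 ≤ dS (Ω u) (Ω e) := Real.arccos_nonneg _
  have hb := (hbilip u e hu he).2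
  have hle : dS (Ω u) (Ω e) ≤ 1 / 5 := by nlinarith
  have h2 := aux_sq (hmap u hu) (hmap e he)
  rw [← aux_cos (hmap u hu) (hmap e he)] at h2
  have h3 := Real.sin_sq_add_cos_sq (dS (Ω u) (Ω e))
  have h4 := Real.sin_le hn'
  have h5 : 0 ≤ Real.sin (dS (Ω u) (Ω e)) :=
    Real.sin_nonneg_of_nonneg_of_le_pi hn' (Real.arccos_le_pi _)
  apply abs_le_of_sq_le_sq _ (by norm_num)
  nlinarith

theorem aux_part2 {δ : ℝ} (hδ0 : 0 ≤ δ) (hδ1 : δ ≤ 1 / 20)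
    {Ω : ℂ → ℂ} (hmap : MapsCircle Ω) (hbilip : BiLipOnCircle Ω δ)
    {e : ℂ} (he : ‖e‖ = 1) {u : ℂ} (hu : ‖u‖ = 1)
    (h : -(1 / 10) ≤ rinner u e) :
    -(1 / 5) ≤ rinner (Ω u) (Ω e) := by
  have hs : dS u e ≤ Real.pi / 2 + 101 / 1000 := by
    have := aux_arcsin (a := -rinner u e) (by linarith)
    rw [Real.arcsin_neg] at this
    rw [dS, Real.arccos_eq_pi_div_two_sub_arcsin]
    linarith
  have hn : 0 ≤ dS u e := Real.arccos_nonneg _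
  have hb := (hbilip u e hu he).2
  have hpi := Real.pi_lt_d2
  have hle : dS (Ω u) (Ω e) - Real.pi / 2 ≤ 1 / 5 := by nlinarith
  rw [← aux_cos (hmap u hu) (hmap e he)]
  have h6 : Real.cos (dS (Ω u) (Ω e)) = - Real.sin (dS (Ω u) (Ω e) - Real.pi / 2) := by
    rw [Real.sin_sub_pi_div_two]; ring
  rw [h6]
  rcases le_total 0 (dS (Ω u) (Ω e) - Real.pi / 2) with h7 | h7
  · linarith [Real.sin_le h7]
  · have := Real.sin_nonpos_of_nonpos_of_neg_pi_le h7 (by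
      have : 0 ≤ dS (Ω u) (Ω e) := Real.arccos_nonneg _
      linarith [Real.pi_pos])
    linarith

/-- Control in absolute value on dot products under `Ω`. -/
theorem stmt_4 (δ : ℝ) (hδ0 : 0 ≤ δ) (hδ1 : δ ≤ 1 / 20)
    (Ω : ℂ → ℂ) (hmap : MapsCircle Ω) (hodd : OddOnCircle Ω)
    (hbilip : BiLipOnCircle Ω δ)
    (e : ℂ) (he : ‖e‖ = 1)
    (ν : ℂ) (hν : ν = Complex.I * Ω e ∨ ν = -(Complex.I * Ω e)) :
    ∀ y : ℂ, y ≠ 0 →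
      (|rinner (y / (‖y‖ : ℂ)) (Complex.I * e)| ≤ 1 / 10 →
        |rinner (Ω (y / (‖y‖ : ℂ))) ν| ≤ 1 / 5) ∧
      (|rinner (y / (‖y‖ : ℂ)) e| ≤ 1 / 10 →
        |rinner (Ω (y / (‖y‖ : ℂ))) (Ω e)| ≤ 1 / 5) := by
  intro y hy
  have hu : ‖y / (‖y‖ : ℂ)‖ = 1 := by
    have : ‖y‖ ≠ 0 := norm_ne_zero_iff.mpr hy
    simp [this]
  generalize y / (‖y‖ : ℂ) = u at hu ⊢
  have hu' : ‖-u‖ = 1 := by rw [norm_neg, hu]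
  constructor
  · intro h
    have key : |rinner (Ω u) (Complex.I * Ω e)| ≤ 1 / 5 := by
      rcases le_total 0 (rinner u e) with h0 | h0
      · exact aux_part1 hδ1 hmap hbilip he hu h0 h
      · have := aux_part1 hδ1 hmap hbilip he hu' (by rw [aux_rneg]; linarith)
          (by rw [aux_rneg, abs_neg]; exact h)
        rwa [hodd u hu, aux_rneg, abs_neg] at this
    rcases hν with rfl | rfl
    · exact key
    · have : rinner (Ω u) (-(Complex.I * Ω e)) = - rinner (Ω u) (Complex.I * Ω e) := by
        simp only [rinner, Complex.neg_re, Complex.neg_im]; ring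
      rwa [this, abs_neg]
  · intro h
    rw [abs_le] at h ⊢
    refine ⟨aux_part2 hδ0 hδ1 hmap hbilip he hu h.1, ?_⟩
    have := aux_part2 hδ0 hδ1 hmap hbilip he hu' (by rw [aux_rneg]; linarith [h.2])
    rw [hodd u hu, aux_rneg] at this
    linarith
end
end

section
/- Let e ∈ 𝕊, let L = ℝe be the line through the origin with direction e, and let ν be a unit normal to the line K(L) = ℝΩ(e), i.e. ν = ±iΩ(e). Then for every y ∈ ℂ∖{0}: |⟨K(y), ν⟩| ≤ 2 · dist(y, L). -/
open MeasureTheory Metric Complex Filter Set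
open scoped Topology ENNReal NNReal

noncomputable section

lemma normsq_one {u : ℂ} (hu : ‖u‖ = 1) : u.re * u.re + u.im * u.im = 1 := by
  have h := Complex.sq_norm u
  rw [hu, Complex.normSq_apply] at h
  linarith

lemma abs_cross_eq {u v : ℂ} (hu : ‖u‖ = 1) (hv : ‖v‖ = 1) :
    |u.im * v.re - u.re * v.im| = Real.sin (dS u v) := by
  have h1 := normsq_one hu
  have h2 := normsq_one hv
  unfold dS rinner
  rw [Real.sin_arccos, ← Real.sqrt_sq_eq_abs]
  congr 1
  linear_combination (v.re * v.re + v.im * v.im) * h1 + h2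

lemma cross_bound_pos (δ : ℝ) (hδ0 : 0 ≤ δ) (hδ1 : δ ≤ 1 / 20)
    (Ω : ℂ → ℂ) (hmap : MapsCircle Ω) (hbilip : BiLipOnCircle Ω δ)
    (e : ℂ) (he : ‖e‖ = 1) (u : ℂ) (hu : ‖u‖ = 1) (hp : 0 ≤ rinner u e) :
    |(Ω u).im * (Ω e).re - (Ω u).re * (Ω e).im| ≤ 2 * |u.im * e.re - u.re * e.im| := by
  rw [abs_cross_eq (hmap u hu) (hmap e he), abs_cross_eq hu he]
  have h1 := (hbilip u e hu he).2
  have h0 : 0 ≤ dS u e := Real.arccos_nonneg _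
  have h2 : dS u e ≤ Real.pi / 2 := Real.arccos_le_pi_div_two.2 hp
  have h3 := Real.mul_le_sin h0 h2
  have h4 : Real.sin (dS (Ω u) (Ω e)) ≤ dS (Ω u) (Ω e) := Real.sin_le (Real.arccos_nonneg _)
  have h5 : (1 + δ) * dS u e ≤ (21 / 20) * dS u e := by
    apply mul_le_mul_of_nonneg_right _ h0
    linarith
  have hpi : (5 / 8 : ℝ) ≤ 2 / Real.pi := by
    rw [le_div_iff₀ Real.pi_pos]
    linarith [Real.pi_lt_d2]
  have h6 : 5 / 8 * dS u e ≤ 2 / Real.pi * dS u e := mul_le_mul_of_nonneg_right hpi h0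
  linarith

lemma cross_bound (δ : ℝ) (hδ0 : 0 ≤ δ) (hδ1 : δ ≤ 1 / 20)
    (Ω : ℂ → ℂ) (hmap : MapsCircle Ω) (hodd : OddOnCircle Ω) (hbilip : BiLipOnCircle Ω δ)
    (e : ℂ) (he : ‖e‖ = 1) (u : ℂ) (hu : ‖u‖ = 1) :
    |(Ω u).im * (Ω e).re - (Ω u).re * (Ω e).im| ≤ 2 * |u.im * e.re - u.re * e.im| := by
  rcases le_total 0 (rinner u e) with hp | hp
  · exact cross_bound_pos δ hδ0 hδ1 Ω hmap hbilip e he u hu hp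
  · have h := cross_bound_pos δ hδ0 hδ1 Ω hmap hbilip e he (-u) (by rwa [norm_neg])
      (by unfold rinner at *; simp only [Complex.neg_re, Complex.neg_im]; linarith)
    rw [hodd u hu] at h
    simp only [Complex.neg_re, Complex.neg_im] at h
    rw [← abs_neg, ← abs_neg (u.im * e.re - u.re * e.im)]
    convert h using 2
    · ring
    · congr 1; ring

lemma abs_cross_le {z e : ℂ} (he : ‖e‖ = 1) : |z.im * e.re - z.re * e.im| ≤ ‖z‖ := by
  refine abs_le_of_sq_le_sq ?_ (norm_nonneg z)
  have h1 := normsq_one he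
  rw [Complex.sq_norm, Complex.normSq_apply]
  nlinarith [sq_nonneg (z.re * e.re + z.im * e.im)]

/-- `|⟨K(y), ν⟩| ≤ 2 dist(y, L)` for `ν` a unit normal to `K(L)`. -/
theorem stmt_5 (δ : ℝ) (hδ0 : 0 ≤ δ) (hδ1 : δ ≤ 1 / 20)
    (Ω : ℂ → ℂ) (hmap : MapsCircle Ω) (hodd : OddOnCircle Ω)
    (hbilip : BiLipOnCircle Ω δ)
    (e : ℂ) (he : ‖e‖ = 1)
    (ν : ℂ) (hν : ν = Complex.I * Ω e ∨ ν = -(Complex.I * Ω e)) :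
    ∀ y : ℂ, y ≠ 0 →
      |rinner (Kmap Ω y) ν| ≤ 2 * infDist y {z : ℂ | ∃ t : ℝ, z = t • e} := by
  intro y hy
  have hn : 0 < ‖y‖ := norm_pos_iff.2 hy
  set u : ℂ := y / (‖y‖ : ℂ) with hu_def
  have hu : ‖u‖ = 1 := by
    rw [hu_def, norm_div, Complex.norm_real, norm_norm, div_self hn.ne']
  have hyu : y = (‖y‖ : ℂ) * u := by
    rw [hu_def, mul_div_cancel₀]
    exact_mod_cast hn.ne'
  have hb := cross_bound δ hδ0 hδ1 Ω hmap hodd hbilip e he u hu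
  have hre : y.re = ‖y‖ * u.re := by
    conv_lhs => rw [hyu]
    simp
  have him : y.im = ‖y‖ * u.im := by
    conv_lhs => rw [hyu]
    simp
  have h1 : |rinner (Kmap Ω y) ν| = ‖y‖ * |(Ω u).im * (Ω e).re - (Ω u).re * (Ω e).im| := by
    have hab : ‖y‖ = |‖y‖| := (abs_norm y).symm
    conv_rhs => rw [hab, ← abs_mul]
    unfold rinner Kmap
    rw [← hu_def]
    rcases hν with h | h
    · rw [h]
      congr 1
      simp
      ring
    · rw [h, ← abs_neg]
      congr 1
      simp
      ring
  have h2 : ‖y‖ * |u.im * e.re - u.re * e.im| = |y.im * e.re - y.re * e.im| := by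
    have hab : ‖y‖ = |‖y‖| := (abs_norm y).symm
    conv_lhs => rw [hab, ← abs_mul]
    rw [hre, him]
    congr 1
    ring
  have h3 : |y.im * e.re - y.re * e.im| ≤ infDist y {z : ℂ | ∃ t : ℝ, z = t • e} := by
    have hne : {z : ℂ | ∃ t : ℝ, z = t • e}.Nonempty := ⟨0, 0, by simp⟩
    rw [le_infDist hne]
    rintro z ⟨t, rfl⟩
    rw [dist_eq_norm]
    convert abs_cross_le (z := y - t • e) he using 2
    simp
    ring
  rw [h1]
  have h4 := mul_le_mul_of_nonneg_left hb hn.le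
  linarith
end
end

section
/- Let Ω : 𝕊 → 𝕊 be an odd Borel map and K(x) = |x| Ω(x/|x|). Let μ be an Ω-symmetric, Ahlfors 1-regular measure on ℂ such that spt(μ) = L for some affine line L ⊂ ℂ. Then there exists a constant c > 0 such that μ = c · H¹|_L. -/
open MeasureTheory Metric Complex Filter Set
open scoped Topology ENNReal NNReal

noncomputable section

lemma real_A (ν : Measure ℝ) [IsLocallyFiniteMeasure ν]
    (h : ∀ s r : ℝ, 0 < r → ∫ t in ball s r, (s - t) ∂ν = 0) (s : ℝ) :
    ν.withDensity (fun t => ENNReal.ofReal (t - s)) =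
      (ν.map (fun t => 2 * s - t)).withDensity (fun t => ENNReal.ofReal (t - s)) := by
  have hσ : Measurable (fun t : ℝ => 2 * s - t) := by fun_prop
  have hd : Measurable (fun t : ℝ => ENNReal.ofReal (t - s)) := by fun_prop
  have hint : ∀ r, IntegrableOn (fun t => s - t) (ball s r) ν := fun r => by
    have : IntegrableOn (fun t => s - t) (closedBall s r) ν :=
      ContinuousOn.integrableOn_compact (isCompact_closedBall s r) (by fun_prop)
    exact this.mono_set ball_subset_closedBall
  have hA : ∀ b, ν.withDensity (fun t => ENNReal.ofReal (t - s)) (Iio b) =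
      ∫⁻ t in ball s (b - s), ENNReal.ofReal (t - s) ∂ν := by
    intro b
    rw [withDensity_apply _ measurableSet_Iio, ← lintegral_indicator measurableSet_Iio,
      ← lintegral_indicator measurableSet_ball]
    congr 1; ext t
    simp only [indicator, mem_Iio, mem_ball, Real.dist_eq]
    by_cases hts : t ≤ s
    · simp [ENNReal.ofReal_of_nonpos (sub_nonpos.2 hts)]
    · rw [abs_of_pos (by linarith)]
      simp
  have hB : ∀ b, (ν.map (fun t => 2 * s - t)).withDensity (fun t => ENNReal.ofReal (t - s)) (Iio b) =
      ∫⁻ t in ball s (b - s), ENNReal.ofReal (s - t) ∂ν := by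
    intro b
    rw [withDensity_apply _ measurableSet_Iio, ← lintegral_indicator measurableSet_Iio,
      ← lintegral_indicator measurableSet_ball, lintegral_map (hd.indicator measurableSet_Iio) hσ]
    congr 1; ext t
    simp only [indicator, mem_Iio, mem_ball, Real.dist_eq]
    have e : 2 * s - t - s = s - t := by ring
    rw [e]
    by_cases hts : s ≤ t
    · simp [ENNReal.ofReal_of_nonpos (sub_nonpos.2 hts)]
    · rw [abs_of_neg (by linarith)]
      have : (2 * s - t < b) ↔ (-(t - s) < b - s) := by constructor <;> intro <;> linarith
      simp only [this]
  have hfinB : ∀ r, ∫⁻ t in ball s r, ENNReal.ofReal (s - t) ∂ν ≠ ∞ := fun r =>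
    (hint r).lintegral_lt_top.ne
  have hfinA : ∀ r, ∫⁻ t in ball s r, ENNReal.ofReal (t - s) ∂ν ≠ ∞ := fun r => by
    have := (hint r).neg.lintegral_lt_top.ne
    simpa using this
  have hAB : ∀ r, ∫⁻ t in ball s r, ENNReal.ofReal (t - s) ∂ν =
      ∫⁻ t in ball s r, ENNReal.ofReal (s - t) ∂ν := by
    intro r
    rcases le_or_gt r 0 with hr | hr
    · simp [ball_eq_empty.2 hr]
    · have h1 := h s r hr
      rw [integral_eq_lintegral_pos_part_sub_lintegral_neg_part (hint r)] at h1
      simp only [neg_sub] at h1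
      exact ((ENNReal.toReal_eq_toReal_iff' (hfinB r) (hfinA r)).1 (sub_eq_zero.1 h1)).symm
  have key : ∀ b, ν.withDensity (fun t => ENNReal.ofReal (t - s)) (Iio b) =
    (ν.map (fun t => 2 * s - t)).withDensity (fun t => ENNReal.ofReal (t - s)) (Iio b) := by
    intro b; rw [hA, hB, hAB]
  have hIco : ∀ (m : Measure ℝ), (∀ b, m (Iio b) ≠ ∞) → ∀ a b, a < b →
      m (Ico a b) = m (Iio b) - m (Iio a) := by
    intro m hm a b hab
    rw [← measure_sdiff (Iio_subset_Iio hab.le) measurableSet_Iio.nullMeasurableSet (hm a)]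
    congr 1; ext x; simp
  have hfA : ∀ b, ν.withDensity (fun t => ENNReal.ofReal (t - s)) (Iio b) ≠ ∞ := fun b => by
    rw [hA]; exact hfinA _
  refine Measure.ext_of_Ico' _ _ (fun a b hab => ?_) (fun a b hab => ?_)
  · exact ne_top_of_le_ne_top (hfA b) (measure_mono Ico_subset_Iio_self)
  · rw [hIco _ hfA a b hab, hIco _ (fun b => by rw [← key]; exact hfA b) a b hab, key, key]

lemma real_restrict (ν ν' : Measure ℝ) (s : ℝ)
    (h : ν.withDensity (fun t => ENNReal.ofReal (t - s)) =
      ν'.withDensity (fun t => ENNReal.ofReal (t - s))) :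
    ν.restrict (Ioi s) = ν'.restrict (Ioi s) := by
  have key : ∀ m : Measure ℝ, m.restrict (Ioi s) =
      ((m.withDensity (fun t => ENNReal.ofReal (t - s))).restrict (Ioi s)).withDensity
        (fun t => (ENNReal.ofReal (t - s))⁻¹) := by
    intro m
    rw [restrict_withDensity measurableSet_Ioi]
    rw [withDensity_inv_same (by fun_prop)]
    · filter_upwards [ae_restrict_mem measurableSet_Ioi] with t ht
      simpa using ht
    · filter_upwards with t using by simp
  rw [key ν, key ν', h]

lemma real_refl (ν : Measure ℝ) [IsLocallyFiniteMeasure ν]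
    (h : ∀ s r : ℝ, 0 < r → ∫ t in ball s r, (s - t) ∂ν = 0) (s : ℝ) :
    ν.map (fun t => 2 * s - t) = ν := by
  have hσ : Measurable (fun t : ℝ => 2 * s - t) := by fun_prop
  have hr := real_restrict _ _ s (real_A ν h s)
  have h1 : ∀ S, MeasurableSet S → ν (S ∩ Ioi s) = ν ((fun t => 2 * s - t) ⁻¹' S ∩ Iio s) := by
    intro S hS
    have := congrArg (fun m => m S) hr
    simp only [Measure.restrict_apply hS] at this
    rw [this, Measure.map_apply hσ (hS.inter measurableSet_Ioi), preimage_inter]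
    congr 2; ext t; simp only [mem_preimage, mem_Ioi, mem_Iio]; constructor <;> intro <;> linarith
  have split : ∀ S, MeasurableSet S → ν S = ν (S ∩ Iio s) + (ν (S ∩ {s}) + ν (S ∩ Ioi s)) := by
    intro S hS
    rw [← measure_inter_add_sdiff S (measurableSet_Iio (a := s))]
    congr 1
    rw [← measure_inter_add_sdiff (S \ Iio s) (measurableSet_singleton s)]
    congr 2
    · ext t; simp; rintro h' -; exact h'.ge
    · ext t; simp only [Set.mem_sdiff, mem_Iio, mem_singleton_iff, mem_inter_iff, mem_Ioi]
      constructor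
      · rintro ⟨⟨a, b⟩, c⟩; exact ⟨a, lt_of_le_of_ne (not_lt.1 b) (Ne.symm c)⟩
      · rintro ⟨a, b⟩; exact ⟨⟨a, not_lt.2 b.le⟩, b.ne'⟩
  ext S hS
  rw [Measure.map_apply hσ hS, split _ (hσ hS), split S hS, h1 _ (hσ hS), ← h1 S hS]
  have e : (fun t => 2 * s - t) ⁻¹' ((fun t => 2 * s - t) ⁻¹' S) = S := by
    ext t; simp
  have e2 : (fun t => 2 * s - t) ⁻¹' S ∩ {s} = S ∩ {s} := by
    ext t; simp only [mem_inter_iff, mem_preimage, mem_singleton_iff]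
    have e3 : 2 * s - s = s := by ring
    constructor <;> rintro ⟨a, b⟩ <;> refine ⟨?_, b⟩ <;> rw [b] at a ⊢
    · rwa [e3] at a
    · rwa [e3]
  rw [e, e2]; ring

lemma real_main (ν : Measure ℝ) [IsLocallyFiniteMeasure ν]
    (h : ∀ s r : ℝ, 0 < r → ∫ t in ball s r, (s - t) ∂ν = 0) :
    ∃ c : ℝ≥0, ν = c • volume := by
  have : ν.IsAddLeftInvariant := by
    refine ⟨fun g => ?_⟩
    have := real_refl ν h (g/2)
    conv_lhs => rw [← real_refl ν h 0]
    rw [Measure.map_map (by fun_prop) (by fun_prop)]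
    conv_rhs => rw [← this]
    congr 1; ext t; simp; ring
  exact ⟨_, Measure.isAddLeftInvariant_eq_smul ν volume⟩

/-- An Ω-symmetric Ahlfors 1-regular measure supported exactly on a
line `L` is a positive multiple of `H¹|_L`. -/
theorem stmt_10 (Ω : ℂ → ℂ) (hmeas : Measurable Ω)
    (hmap : MapsCircle Ω) (hodd : OddOnCircle Ω)
    (μ : Measure ℂ) [IsLocallyFiniteMeasure μ]
    (C₀ : ℝ) (hC₀ : 0 < C₀) (hreg : Ahlfors1 μ C₀)
    (hsym : OmegaSym Ω μ)
    (L : Set ℂ) (hL : IsLine L) (hspt : spt μ = L) :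
    ∃ c : ℝ, 0 < c ∧
      μ = ENNReal.ofReal c •
        ((MeasureTheory.Measure.hausdorffMeasure 1 : Measure ℂ).restrict L) := by
  obtain ⟨a, b₀, hb₀, rfl⟩ := hL
  obtain ⟨b, hb, hLb⟩ : ∃ b : ℂ, ‖b‖ = 1 ∧
      {z : ℂ | ∃ t : ℝ, z = a + t • b₀} = range (fun t : ℝ => a + (t : ℂ) * b) := by
    have hn : (‖b₀‖ : ℂ) ≠ 0 := by simpa using hb₀
    refine ⟨b₀ / ‖b₀‖, by simp [hb₀], ?_⟩
    ext z
    simp only [mem_setOf_eq, mem_range, Complex.real_smul]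
    constructor
    · rintro ⟨t, rfl⟩
      exact ⟨t * ‖b₀‖, by push_cast; field_simp⟩
    · rintro ⟨t, rfl⟩
      exact ⟨t / ‖b₀‖, by push_cast; field_simp⟩
  rw [hLb] at hspt ⊢
  clear hLb
  set f : ℝ → ℂ := fun t => a + (t : ℂ) * b with hf
  have hfm : Measurable f := by fun_prop
  have hfi : Isometry f := by
    refine Isometry.of_dist_eq fun x y => ?_
    have : f x - f y = ((x - y : ℝ) : ℂ) * b := by simp only [hf]; push_cast; ring
    rw [dist_eq_norm, this, norm_mul, hb, Complex.norm_real, mul_one, dist_eq_norm]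
  have hfe : MeasurableEmbedding f := hfi.isClosedEmbedding.measurableEmbedding
  have hnull : μ (range f)ᶜ = 0 := by
    apply measure_null_of_locally_null
    intro x hx
    rw [← hspt] at hx
    simp only [spt, mem_compl_iff, mem_setOf_eq, not_forall, not_lt, nonpos_iff_eq_zero] at hx
    obtain ⟨r, hr, h0⟩ := hx
    exact ⟨ball x r, mem_nhdsWithin_of_mem_nhds (ball_mem_nhds x hr), h0⟩
  set ν : Measure ℝ := μ.comap f with hν
  have hμν : ν.map f = μ := by
    rw [hν, hfe.map_comap, Measure.restrict_eq_self_of_ae_mem]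
    exact hnull
  have hpre : ∀ s r, f ⁻¹' ball (f s) r = ball s r := fun s r => by
    exact hfi.preimage_ball s r
  have hνloc : IsLocallyFiniteMeasure ν := by
    refine ⟨fun s => ⟨ball s 1, ball_mem_nhds s one_pos, ?_⟩⟩
    rw [← hpre, ← hfe.map_apply, hμν]
    exact measure_ball_lt_top
  have hK : ∀ s t, Kmap Ω (f s - f t) = ((s - t : ℝ) : ℂ) * Ω b := by
    intro s t
    have e : f s - f t = ((s - t : ℝ) : ℂ) * b := by simp only [hf]; push_cast; ring
    have en : ‖f s - f t‖ = |s - t| := by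
      rw [e, norm_mul, hb, Complex.norm_real, mul_one, Real.norm_eq_abs]
    rw [Kmap, en, e]
    rcases lt_trichotomy (s - t) 0 with h | h | h
    · have hc : ((s - t : ℝ) : ℂ) ≠ 0 := by exact_mod_cast h.ne
      rw [abs_of_neg h]
      have : ((s - t : ℝ) : ℂ) * b / ((-(s - t) : ℝ) : ℂ) = -b := by
        rw [Complex.ofReal_neg, div_neg, mul_div_cancel_left₀ _ hc]
      rw [this, hodd b hb, Complex.ofReal_neg]; ring
    · simp [h]
    · have hc : ((s - t : ℝ) : ℂ) ≠ 0 := by exact_mod_cast h.ne'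
      rw [abs_of_pos h, mul_div_cancel_left₀ _ hc]
  have hΩb : Ω b ≠ 0 := by
    intro h0
    have := hmap b hb
    simp [h0] at this
  have hs : ∀ s r : ℝ, 0 < r → ∫ t in ball s r, (s - t) ∂ν = 0 := by
    intro s r hr
    have h1 := hsym (f s) (by rw [hspt]; exact mem_range_self s) r hr
    rw [← hμν, hfe.setIntegral_map, hpre] at h1
    simp only [hK] at h1
    rw [integral_mul_const, integral_complex_ofReal] at h1
    simpa [hΩb] using h1
  obtain ⟨c, hc⟩ := real_main ν hs
  have hH : (volume : Measure ℝ).map f =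
      (MeasureTheory.Measure.hausdorffMeasure 1 : Measure ℂ).restrict (range f) := by
    rw [← hausdorffMeasure_real]
    exact hfi.map_hausdorffMeasure (Or.inl zero_le_one)
  have hμc : μ = c • (volume : Measure ℝ).map f := by
    rw [← hμν, hc, Measure.map_smul]
  refine ⟨c, ?_, ?_⟩
  · rw [NNReal.coe_pos, pos_iff_ne_zero]
    rintro rfl
    have h1 : f 0 ∈ spt μ := by rw [hspt]; exact mem_range_self 0
    have h2 := h1 1 one_pos
    rw [hμc] at h2
    simp at h2
  · rw [← hH, ENNReal.ofReal_coe_nnreal]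
    exact hμc
end
end

section
/- Suppose in addition that Ω is twice continuously differentiable. Let μ be a Radon measure on ℂ such that for μ-almost every x ∈ ℂ: (i) 0 < liminf_{r↓0} μ(B(x,r))/r and limsup_{r↓0} μ(B(x,r))/r < ∞; (ii) y ↦ K(x−y)/|x−y|² is μ-integrable on ℂ∖B(x,ε) for every ε > 0 and lim_{ε↓0} ∫_{ℂ∖B(x,ε)} K(x−y)/|x−y|² dμ(y) exists in ℂ. Then for μ-almost every x₀ ∈ ℂ, every tangent measure ν ∈ Tan(μ, x₀) is Ω-symmetric: ∫_{B(z,r)} K(z−y) dν(y) = 0 for every z ∈ spt(ν) and every r > 0. -/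
open MeasureTheory Metric Complex Filter Set
open scoped Topology ENNReal NNReal

noncomputable section

/-- `ν` is a tangent measure of `μ` at `x`: for some `cᵢ > 0` and `rᵢ ↓ 0`,
`cᵢ (T_{x,rᵢ})_* μ → ν` weakly against compactly supported continuous functions. -/
def IsTangentMeasure (μ : Measure ℂ) (x : ℂ) (ν : Measure ℂ) : Prop :=
  ∃ c : ℕ → ℝ, ∃ r : ℕ → ℝ, (∀ i, 0 < c i) ∧ (∀ i, 0 < r i) ∧
    Tendsto r atTop (𝓝 (0 : ℝ)) ∧
    ∀ f : ℂ → ℝ, Continuous f → HasCompactSupport f →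
      Tendsto (fun i => c i * ∫ y, f ((y - x) / ((r i : ℝ) : ℂ)) ∂μ) atTop
        (𝓝 (∫ y, f y ∂ν))


theorem norm_Kmap' {Ω : ℂ → ℂ} (hmap : MapsCircle Ω) (x : ℂ) : ‖Kmap Ω x‖ = ‖x‖ := by
  by_cases hx : x = 0
  · simp [Kmap, hx]
  · have h : ‖x / (‖x‖ : ℂ)‖ = 1 := by
      have : ‖x‖ ≠ 0 := norm_ne_zero_iff.2 hx
      simp [this]
    simp [Kmap, hmap _ h]

theorem continuous_Kmap {Ω : ℂ → ℂ} (hmap : MapsCircle Ω) (hC2 : CircleCk Ω 2) :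
    Continuous (Kmap Ω) := by
  obtain ⟨ω, hω, hΩ⟩ := hC2
  rw [continuous_iff_continuousAt]
  intro x₀
  by_cases hx : x₀ = 0
  · subst hx
    have h0 : Kmap Ω 0 = 0 := by simp [Kmap]
    rw [ContinuousAt, h0]
    apply squeeze_zero_norm (a := fun x : ℂ => ‖x‖)
    · intro x; rw [norm_Kmap' hmap]
    · simpa using (continuous_norm (E := ℂ)).tendsto 0
  · have key : (fun x : ℂ => (‖x‖ : ℂ) *
        Complex.exp ((ω (arg (x / x₀) + arg x₀) : ℂ) * Complex.I)) =ᶠ[𝓝 x₀] Kmap Ω := by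
      filter_upwards [isOpen_ne.mem_nhds hx] with x hx1
      have hx1 : x ≠ 0 := hx1
      rw [Kmap, ← hΩ]
      congr 2
      have e : ∀ u : ℂ, u ≠ 0 → Complex.exp ((arg u : ℂ) * Complex.I) = u / (‖u‖ : ℂ) := by
        intro u hu
        have : (‖u‖ : ℂ) ≠ 0 := by exact_mod_cast norm_ne_zero_iff.2 hu
        rw [eq_div_iff this, mul_comm]
        exact norm_mul_exp_arg_mul_I u
      push_cast
      rw [add_mul, Complex.exp_add, e _ (div_ne_zero hx1 hx), e _ hx]
      have h1 : (‖x‖ : ℂ) ≠ 0 := by exact_mod_cast norm_ne_zero_iff.2 hx1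
      have h2 : (‖x₀‖ : ℂ) ≠ 0 := by exact_mod_cast norm_ne_zero_iff.2 hx
      rw [norm_div]
      push_cast
      field_simp
    refine ContinuousAt.congr ?_ key
    have harg : ContinuousAt (fun x : ℂ => arg (x / x₀)) x₀ := by
      have : ContinuousAt arg (x₀ / x₀) := by
        rw [div_self hx]; exact continuousAt_arg (by simp)
      exact ContinuousAt.comp (f := fun x : ℂ => x / x₀) this (by fun_prop)
    have hωc : Continuous ω := hω.continuous
    have h3 : ContinuousAt (fun x : ℂ => ω (arg (x / x₀) + arg x₀)) x₀ :=
      hωc.continuousAt.comp (harg.add continuousAt_const)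
    have h4 : ContinuousAt (fun x : ℂ => (ω (arg (x / x₀) + arg x₀) : ℂ)) x₀ :=
      Complex.continuous_ofReal.continuousAt.comp h3
    have h5 : ContinuousAt (fun x : ℂ => (‖x‖ : ℂ)) x₀ := by fun_prop
    exact h5.mul (h4.mul continuousAt_const).cexp

theorem radial_bound (μ : Measure ℂ) [IsLocallyFiniteMeasure μ] (x : ℂ) (k : ℂ → ℂ)
    (hkm : Measurable k) (a b ε D B : ℝ) (hab : a < b) (hD0 : 0 ≤ D)
    (hkB : ∀ y, a ≤ ‖x - y‖ → ‖k y‖ ≤ B) (φ : ℝ → ℝ) (hφ : ContDiff ℝ 1 φ)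
    (h0 : ∀ t ≤ a, φ t = 0) (h1 : ∀ t, b ≤ t → φ t = 0) (hD : ∀ t, |deriv φ t| ≤ D)
    (hann : ∀ s ∈ Ioc a b, ‖∫ y in ball x s \ ball x a, k y ∂μ‖ ≤ ε) :
    ‖∫ y, φ ‖x - y‖ • k y ∂μ‖ ≤ ε * D * (b - a) := by
  have hcd : Continuous (deriv φ) := hφ.continuous_deriv le_rfl
  have hdiff : Differentiable ℝ φ := hφ.differentiable (by norm_num)
  set S : Set ℂ := ball x b \ ball x a with hS
  have hSm : MeasurableSet S := measurableSet_ball.diff measurableSet_ball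
  have hmS : ∀ y, y ∈ S ↔ ‖x - y‖ < b ∧ a ≤ ‖x - y‖ := by
    intro y; simp [hS, dist_eq_norm, norm_sub_rev y x]
  have hSfin : μ S < ⊤ := (measure_mono sdiff_subset).trans_lt measure_ball_lt_top
  have : IsFiniteMeasure (μ.restrict S) := ⟨by simpa using hSfin⟩
  set f : ℂ → ℝ → ℂ := fun y s => (if ‖x - y‖ < s then deriv φ s else 0) • k y with hf
  have e1 : ∫ y, φ ‖x - y‖ • k y ∂μ = ∫ y in S, φ ‖x - y‖ • k y ∂μ := by
    symm
    apply setIntegral_eq_integral_of_forall_compl_eq_zero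
    intro y hy
    rw [hmS] at hy
    by_cases hb : ‖x - y‖ < b
    · rw [h0 _ (by by_contra hh; exact hy ⟨hb, by linarith⟩), zero_smul]
    · rw [h1 _ (not_lt.1 hb), zero_smul]
  have e2 : ∀ y ∈ S, φ ‖x - y‖ • k y = - ∫ s in Ioc a b, f y s := by
    intro y hy
    rw [hmS] at hy
    have : ∫ s in Ioc a b, f y s = (∫ s in Ioc a b, (if ‖x - y‖ < s then deriv φ s else 0)) • k y := by
      rw [← integral_smul_const]
    rw [this]
    have h2 : ∫ s in Ioc a b, (if ‖x - y‖ < s then deriv φ s else 0)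
        = ∫ s in Ioc (‖x - y‖) b, deriv φ s := by
      have : (fun s => if ‖x - y‖ < s then deriv φ s else 0) = (Ioi ‖x - y‖).indicator (deriv φ) := by
        ext s; simp [indicator]
      rw [this, setIntegral_indicator measurableSet_Ioi]
      congr 2
      ext s; simp only [mem_inter_iff, mem_Ioc, mem_Ioi]
      constructor
      · rintro ⟨⟨_, h⟩, h'⟩; exact ⟨h', h⟩
      · rintro ⟨h, h'⟩; exact ⟨⟨by linarith, h'⟩, h⟩
    rw [h2, ← intervalIntegral.integral_of_le hy.1.le,
      intervalIntegral.integral_deriv_eq_sub (fun t _ => hdiff t) (hcd.intervalIntegrable _ _),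
      h1 b le_rfl]
    simp
  have hint : Integrable (Function.uncurry f)
      ((μ.restrict S).prod (volume.restrict (Ioc a b))) := by
    have hmeas : Measurable (Function.uncurry f) := by
      have hm : Measurable (fun p : ℂ × ℝ => if ‖x - p.1‖ < p.2 then deriv φ p.2 else 0) := by
        refine Measurable.ite ?_ (hcd.measurable.comp measurable_snd) measurable_const
        exact measurableSet_lt (by fun_prop) (by fun_prop)
      exact hm.smul (hkm.comp measurable_fst)
    refine Integrable.of_bound hmeas.aestronglyMeasurable (D * B) ?_
    have hae : ∀ᵐ p ∂((μ.restrict S).prod (volume.restrict (Ioc a b))), p.1 ∈ S :=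
      Measure.quasiMeasurePreserving_fst.ae (ae_restrict_mem hSm)
    filter_upwards [hae] with p hp
    rw [hmS] at hp
    simp only [Function.uncurry, hf, norm_smul]
    have := hkB p.1 hp.2
    gcongr
    split_ifs
    · exact hD _
    · simpa using hD0
  rw [e1, setIntegral_congr_fun hSm e2, integral_neg, norm_neg, integral_integral_swap hint]
  have hvol : (volume.real (Ioc a b)) = b - a := by
    simp [measureReal_def, hab.le]
  rw [← hvol]
  apply norm_setIntegral_le_of_norm_le_const (by simp)
  intro s hs
  have e3 : ∫ y in S, f y s ∂μ = deriv φ s • ∫ y in ball x s \ ball x a, k y ∂μ := by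
    have : ∀ y, f y s = (ball x s).indicator (fun y => deriv φ s • k y) y := by
      intro y
      by_cases h : ‖x - y‖ < s
      · simp [hf, h, indicator, dist_eq_norm, norm_sub_rev y x]
      · simp [hf, h, indicator, dist_eq_norm, norm_sub_rev y x]
    simp_rw [this]
    rw [setIntegral_indicator measurableSet_ball, integral_smul]
    congr 3
    ext y
    simp only [mem_inter_iff, hS, Set.mem_sdiff, mem_ball]
    constructor
    · rintro ⟨⟨_, h⟩, h'⟩; exact ⟨h', h⟩
    · rintro ⟨h, h'⟩; exact ⟨⟨by linarith [hs.2], h'⟩, h⟩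
  rw [e3, norm_smul, mul_comm]
  exact mul_le_mul (hann s hs) (hD s) (norm_nonneg _) ((norm_nonneg _).trans (hann s hs))

theorem integrable_scaled {E : Type*} [NormedAddCommGroup E] (μ : Measure ℂ) [IsLocallyFiniteMeasure μ]
    (f : ℂ → E) (hf : Continuous f) (hcs : HasCompactSupport f) (x : ℂ) (r : ℝ) (hr : 0 < r) :
    Integrable (fun y => f ((y - x) / (r : ℂ))) μ := by
  have hr' : (r : ℂ) ≠ 0 := by exact_mod_cast hr.ne'
  apply Continuous.integrable_of_hasCompactSupport
  · exact hf.comp (by fun_prop)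
  · have := hcs.comp_homeomorph ((Homeomorph.subRight x).trans (Homeomorph.mulRight₀ _ (inv_ne_zero hr')))
    exact this

def TConv (μ : Measure ℂ) (x : ℂ) (ν : Measure ℂ) (c r : ℕ → ℝ) : Prop :=
  ∀ f : ℂ → ℝ, Continuous f → HasCompactSupport f →
      Tendsto (fun i => c i * ∫ y, f ((y - x) / ((r i : ℝ) : ℂ)) ∂μ) atTop
        (𝓝 (∫ y, f y ∂ν))

theorem cone_cs (z : ℂ) (d : ℝ) : HasCompactSupport (fun w : ℂ => max 0 (d - ‖w - z‖)) := by
  apply HasCompactSupport.intro (isCompact_closedBall z d)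
  intro w hw
  have : d < ‖w - z‖ := by simpa [dist_eq_norm] using hw
  exact max_eq_left (by linarith)

theorem mass_bound (μ : Measure ℂ) [IsLocallyFiniteMeasure μ] (x : ℂ) (ν : Measure ℂ) (c r : ℕ → ℝ)
    (hc : ∀ i, 0 < c i) (hr : ∀ i, 0 < r i) (hconv : TConv μ x ν c r) (R : ℝ) :
    ∃ M : ℝ, 0 < M ∧ ∀ᶠ i in atTop, c i * μ.real (closedBall x (R * r i)) ≤ M := by
  set f : ℂ → ℝ := fun w => max 0 (R + 1 - ‖w - 0‖) with hf
  have hfc : Continuous f := by fun_prop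
  have hcs : HasCompactSupport f := cone_cs 0 (R + 1)
  refine ⟨|∫ y, f y ∂ν| + 1, by positivity, ?_⟩
  filter_upwards [(hconv f hfc hcs).eventually_lt_const
    (show (∫ y, f y ∂ν) < |∫ y, f y ∂ν| + 1 by linarith [le_abs_self (∫ y, f y ∂ν)])] with i hi
  refine le_trans (mul_le_mul_of_nonneg_left ?_ (hc i).le) hi.le
  rw [← integral_indicator_one measurableSet_closedBall]
  apply integral_mono_of_nonneg
  · exact Eventually.of_forall fun y => indicator_nonneg (by simp) _
  · exact integrable_scaled μ f hfc hcs x (r i) (hr i)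
  · refine Eventually.of_forall fun y => ?_
    by_cases hy : y ∈ closedBall x (R * r i)
    · simp only [indicator_of_mem hy, Pi.one_apply, hf]
      apply le_max_of_le_right
      have h1 : ‖y - x‖ ≤ R * r i := by simpa [dist_eq_norm] using hy
      have : ‖(y - x) / (r i : ℂ) - 0‖ ≤ R := by
        rw [sub_zero, norm_div, Complex.norm_real, Real.norm_of_nonneg (hr i).le, div_le_iff₀ (hr i)]
        exact h1
      linarith
    · simp only [indicator_of_notMem hy]
      exact le_max_left _ _

theorem find_pt (μ : Measure ℂ) [IsLocallyFiniteMeasure μ] (x : ℂ) (ν : Measure ℂ)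
    [IsLocallyFiniteMeasure ν] (c r : ℕ → ℝ)
    (hc : ∀ i, 0 < c i) (hr : ∀ i, 0 < r i) (hr0 : Tendsto r atTop (𝓝 0))
    (hconv : TConv μ x ν c r) (A : Set ℂ)
    (hA : Tendsto (fun r => μ (A ∩ closedBall x r) / μ (closedBall x r)) (𝓝[>] 0) (𝓝 1))
    (z : ℂ) (hz : z ∈ spt ν) (d : ℝ) (hd : 0 < d) :
    ∀ᶠ i in atTop, ∃ p ∈ A, ‖(p - x) / (r i : ℂ) - z‖ < d := by
  set f : ℂ → ℝ := fun w => max 0 (d - ‖w - z‖) with hf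
  have hfc : Continuous f := by fun_prop
  have hcs : HasCompactSupport f := cone_cs z d
  have hf0 : 0 ≤ f := fun w => le_max_left _ _
  obtain ⟨η, hη⟩ : ∃ η, η = ∫ y, f y ∂ν := ⟨_, rfl⟩
  have hηpos : 0 < η := by
    rw [hη, integral_pos_iff_support_of_nonneg hf0 (hfc.integrable_of_hasCompactSupport hcs)]
    refine (hz d hd).trans_le (measure_mono ?_)
    intro w hw
    have : ‖w - z‖ < d := by simpa [dist_eq_norm] using hw
    simp only [Function.mem_support, hf]
    exact (lt_max_of_lt_right (by linarith)).ne'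
  obtain ⟨ρ, hρ⟩ : ∃ ρ, ρ = ‖z‖ + d := ⟨_, rfl⟩
  have hρpos : 0 < ρ := by rw [hρ]; positivity
  obtain ⟨M, hM, hMi⟩ := mass_bound μ x ν c r hc hr hconv ρ
  obtain ⟨τ, hτ⟩ : ∃ τ, τ = η / (2 * d * M) := ⟨_, rfl⟩
  have hτpos : 0 < τ := by rw [hτ]; positivity
  have hρr : Tendsto (fun i => ρ * r i) atTop (𝓝[>] 0) := by
    apply tendsto_nhdsWithin_of_tendsto_nhds_of_eventually_within
    · simpa using hr0.const_mul ρ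
    · exact Eventually.of_forall fun i => mul_pos hρpos (hr i)
  have hA' := (ENNReal.tendsto_toReal ENNReal.one_ne_top).comp (hA.comp hρr)
  rw [ENNReal.toReal_one] at hA'
  filter_upwards [hMi, hA'.eventually_const_lt (show 1 - τ < 1 by linarith),
    (hconv f hfc hcs).eventually_const_lt (show η / 2 < ∫ y, f y ∂ν by rw [← hη]; linarith)]
    with i h1 h2 h3
  have hri : (r i : ℂ) ≠ 0 := by exact_mod_cast (hr i).ne'
  by_contra! hcon
  set small := ball (x + r i * z) (d * r i) with hsmall
  set Big := closedBall x (ρ * r i) with hBig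
  have hBfin : μ Big ≠ ⊤ := measure_closedBall_lt_top.ne
  have hsub : small ⊆ Big := by
    apply (ball_subset_closedBall).trans
    apply closedBall_subset_closedBall'
    rw [dist_eq_norm, add_sub_cancel_left, norm_mul, Complex.norm_real,
      Real.norm_of_nonneg (hr i).le, hρ]
    linarith
  have hmem : ∀ y, y ∈ small ↔ ‖(y - x) / (r i : ℂ) - z‖ < d := by
    intro y
    have : (y - x) / (r i : ℂ) - z = (y - (x + r i * z)) / (r i : ℂ) := by field_simp; ring
    rw [this, norm_div, Complex.norm_real, Real.norm_of_nonneg (hr i).le, div_lt_iff₀ (hr i),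
      hsmall, mem_ball, dist_eq_norm]
  have hle : ∫ y, f ((y - x) / (r i : ℂ)) ∂μ ≤ d * μ.real small := by
    have : d * μ.real small = ∫ y, small.indicator (fun _ => d) y ∂μ := by
      rw [integral_indicator_const _ measurableSet_ball, smul_eq_mul, mul_comm]
    rw [this]
    apply integral_mono (integrable_scaled μ f hfc hcs x (r i) (hr i))
    · exact (integrable_indicator_iff measurableSet_ball).2
        (integrableOn_const measure_ball_lt_top.ne)
    · intro y
      by_cases hy : y ∈ small
      · simp only [indicator_of_mem hy, hf]
        exact max_le hd.le (by linarith [norm_nonneg ((y - x) / (r i : ℂ) - z)])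
      · simp only [indicator_of_notMem hy, hf]
        rw [hmem, not_lt] at hy
        exact max_le le_rfl (by linarith)
  have hadd : μ.real (A ∩ Big) + μ.real small ≤ μ.real Big := by
    have e : μ.real (Big \ small) + μ.real small = μ.real Big := by
      rw [measureReal_sdiff hsub measurableSet_ball hBfin]
      ring
    rw [← e]
    gcongr
    · exact measure_ne_top_of_subset sdiff_subset hBfin
    · rintro y ⟨hyA, hyB⟩
      exact ⟨hyB, fun hy => absurd ((hmem y).1 hy) (not_lt.2 (hcon y hyA))⟩
  have hsp : 0 < c i * μ.real small := by
    have : η / 2 < c i * (d * μ.real small) :=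
      h3.trans_le (mul_le_mul_of_nonneg_left hle (hc i).le)
    by_contra! hh
    nlinarith
  have hBpos : 0 < μ.real Big := by
    have : 0 < μ.real small := by
      rcases (measureReal_nonneg (μ := μ) (s := small)).eq_or_lt with h | h
      · rw [← h] at hsp; simp at hsp
      · exact h
    linarith [measureReal_nonneg (μ := μ) (s := A ∩ Big)]
  have h2' : 1 - τ < μ.real (A ∩ Big) / μ.real Big := by
    simpa [measureReal_def, ENNReal.toReal_div] using h2
  rw [lt_div_iff₀ hBpos] at h2'
  have h4 : μ.real small < τ * μ.real Big := by linarith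
  have h5 : c i * μ.real small < τ * M :=
    calc c i * μ.real small < c i * (τ * μ.real Big) := mul_lt_mul_of_pos_left h4 (hc i)
      _ = τ * (c i * μ.real Big) := by ring
      _ ≤ τ * M := by gcongr
  have h6 : η / 2 < d * (τ * M) := calc
    η / 2 < c i * (d * μ.real small) := h3.trans_le (mul_le_mul_of_nonneg_left hle (hc i).le)
    _ = d * (c i * μ.real small) := by ring
    _ ≤ d * (τ * M) := by gcongr
  have h7 : d * (τ * M) = η / 2 := by rw [hτ]; field_simp
  linarith

theorem tconv_complex {μ : Measure ℂ} [IsLocallyFiniteMeasure μ] {x : ℂ} {ν : Measure ℂ}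
    [IsLocallyFiniteMeasure ν] {c r : ℕ → ℝ}
    (hr : ∀ i, 0 < r i) (hconv : TConv μ x ν c r) (F : ℂ → ℂ) (hF : Continuous F)
    (hcs : HasCompactSupport F) :
    Tendsto (fun i => (c i : ℂ) * ∫ y, F ((y - x) / ((r i : ℝ) : ℂ)) ∂μ) atTop
        (𝓝 (∫ y, F y ∂ν)) := by
  have h1 := hconv (fun w => (F w).re) (by fun_prop) (hcs.comp_left (g := Complex.re) rfl)
  have h2 := hconv (fun w => (F w).im) (by fun_prop) (hcs.comp_left (g := Complex.im) rfl)
  have h3 := ((Complex.continuous_ofReal.tendsto _).comp h1).add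
    (((Complex.continuous_ofReal.tendsto _).comp h2).mul_const Complex.I)
  have hν := hF.integrable_of_hasCompactSupport (μ := ν) hcs
  have e : ∀ (m : Measure ℂ) (G : ℂ → ℂ), Integrable G m →
      ((∫ y, (G y).re ∂m : ℝ) : ℂ) + ((∫ y, (G y).im ∂m : ℝ) : ℂ) * Complex.I = ∫ y, G y ∂m := by
    intro m G hG
    exact integral_re_add_im hG
  rw [e ν F hν] at h3
  refine h3.congr fun i => ?_
  rw [← e μ _ (integrable_scaled μ F hF hcs x (r i) (hr i))]
  simp only [Function.comp]
  push_cast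
  ring

/-- good point: uniform smallness of annular integrals on sets of density one -/
def GoodPt (Ω : ℂ → ℂ) (μ : Measure ℂ) (x : ℂ) : Prop :=
  ∀ e : ℝ, 0 < e → ∃ (A : Set ℂ) (ρ : ℝ), 0 < ρ ∧
    Tendsto (fun r => μ (A ∩ closedBall x r) / μ (closedBall x r)) (𝓝[>] 0) (𝓝 1) ∧
    ∀ p ∈ A, ∀ a s : ℝ, 0 < a → a < s → s < ρ →
      ‖∫ y in ball p s \ ball p a, Kmap Ω (p - y) / ((‖p - y‖ : ℂ)) ^ 2 ∂μ‖ ≤ e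

theorem main_smooth {Ω : ℂ → ℂ} (hmap : MapsCircle Ω) (hK : Continuous (Kmap Ω))
    (μ : Measure ℂ) [IsLocallyFiniteMeasure μ] (x : ℂ) (ν : Measure ℂ)
    [IsLocallyFiniteMeasure ν] (c r : ℕ → ℝ)
    (hc : ∀ i, 0 < c i) (hr : ∀ i, 0 < r i) (hr0 : Tendsto r atTop (𝓝 0))
    (hconv : TConv μ x ν c r) (hgood : GoodPt Ω μ x)
    (hlow : ∃ q : ℝ, 0 < q ∧ ∀ᶠ t in 𝓝[>] (0 : ℝ), q * t ≤ μ.real (ball x t))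
    (z : ℂ) (hz : z ∈ spt ν) (h : ℝ → ℝ) (hh : ContDiff ℝ 1 h) (a b : ℝ) (ha : 0 < a) (hab : a < b)
    (h0 : ∀ t ≤ a, h t = 0) (h1 : ∀ t, b ≤ t → h t = 0) :
    ∫ w, h ‖z - w‖ • Kmap Ω (z - w) ∂ν = 0 := by
  set ψ : ℂ → ℂ := fun v => h ‖v‖ • Kmap Ω v with hψ
  have hhc : Continuous h := hh.continuous
  have hψc : Continuous ψ := (hhc.comp continuous_norm).smul hK
  have hψ0 : ∀ v, b ≤ ‖v‖ → ψ v = 0 := fun v hv => by simp [hψ, h1 _ hv]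
  have hψcs : HasCompactSupport ψ := by
    apply HasCompactSupport.intro (isCompact_closedBall 0 b)
    intro v hv
    have : b < ‖v‖ := by simpa using hv
    exact hψ0 v this.le
  have hψu : UniformContinuous ψ := hψcs.uniformContinuous_of_continuous hψc
  set φ : ℝ → ℝ := fun t => t ^ 2 * h t with hφ
  have hφC : ContDiff ℝ 1 φ := (contDiff_id.pow 2).mul hh
  have hφcs : HasCompactSupport φ := by
    apply HasCompactSupport.intro (isCompact_Icc (a := a) (b := b))
    intro t ht
    by_cases hta : t ≤ a
    · simp [hφ, h0 t hta]
    · have : b ≤ t := by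
        by_contra hb; exact ht ⟨by linarith, by linarith⟩
      simp [hφ, h1 t this]
  obtain ⟨D, hD⟩ := hφcs.deriv.exists_bound_of_continuous (hφC.continuous_deriv le_rfl)
  have hD0 : 0 ≤ D := (norm_nonneg _).trans (hD 0)
  -- bound on c i * r i
  obtain ⟨M₁, hM₁⟩ : ∃ M : ℝ, ∀ᶠ i in atTop, c i * r i ≤ M := by
    obtain ⟨q, hq, hqe⟩ := hlow
    obtain ⟨M, hM, hMi⟩ := mass_bound μ x ν c r hc hr hconv 1
    have hr' : Tendsto r atTop (𝓝[>] 0) :=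
      tendsto_nhdsWithin_of_tendsto_nhds_of_eventually_within _ hr0 (Eventually.of_forall hr)
    refine ⟨M / q, ?_⟩
    filter_upwards [hMi, hr'.eventually hqe] with i hi1 hi2
    rw [le_div_iff₀ hq]
    rw [one_mul] at hi1
    have : μ.real (ball x (r i)) ≤ μ.real (closedBall x (r i)) :=
      measureReal_mono ball_subset_closedBall measure_closedBall_lt_top.ne
    calc c i * r i * q = c i * (q * r i) := by ring
      _ ≤ c i * μ.real (closedBall x (r i)) := by
        have := (hc i).le
        gcongr
        linarith
      _ ≤ M := hi1
  obtain ⟨M₂, hM₂0, hM₂⟩ := mass_bound μ x ν c r hc hr hconv (‖z‖ + 1 + b)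
  have hlim := tconv_complex hr hconv (fun w => ψ (z - w)) (by fun_prop)
    (hψcs.comp_homeomorph (Homeomorph.subLeft z))
  have main : ∀ e : ℝ, 0 < e → ‖∫ w, ψ (z - w) ∂ν‖ ≤ e * (D * (b - a) * M₁ + M₂) := by
    intro e he
    obtain ⟨A, ρ, hρ, hAd, hAe⟩ := hgood e he
    obtain ⟨d', hd', hdu⟩ := Metric.uniformContinuous_iff.1 hψu e he
    obtain ⟨d, hd, hdd', hd1⟩ : ∃ d : ℝ, 0 < d ∧ d ≤ d' ∧ d ≤ 1 :=
      ⟨min d' 1, by positivity, min_le_left _ _, min_le_right _ _⟩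
    refine le_of_tendsto hlim.norm ?_
    have hbr : ∀ᶠ i in atTop, b * r i < ρ := by
      have : Tendsto (fun i => b * r i) atTop (𝓝 0) := by simpa using hr0.const_mul b
      exact this.eventually_lt_const hρ
    filter_upwards [hM₁, hM₂, hbr, find_pt μ x ν c r hc hr hr0 hconv A hAd z hz d hd]
      with i hi1 hi2 hi3 hi4
    obtain ⟨p, hpA, hpd⟩ := hi4
    have hri := hr i
    have hci := hc i
    have hriC : (r i : ℂ) ≠ 0 := by exact_mod_cast hri.ne'
    set zi := (p - x) / (r i : ℂ) with hzi
    have hzi' : ∀ y, zi - (y - x) / (r i : ℂ) = (p - y) / (r i : ℂ) := by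
      intro y; rw [hzi]; field_simp; ring
    -- estimate at p
    have est1 : ‖∫ y, ψ (zi - (y - x) / (r i : ℂ)) ∂μ‖ ≤ r i * (e * D * (b - a)) := by
      have hb := radial_bound μ p (fun y => Kmap Ω (p - y) / ((‖p - y‖ : ℂ)) ^ 2)
        (by
          have : Measurable (Kmap Ω) := hK.measurable
          fun_prop)
        (r i * a) (r i * b) e (D / r i) (1 / (r i * a)) (by gcongr) (by positivity)
        (by
          intro y hy
          have hpos : 0 < r i * a := by positivity
          have hpos' : 0 < ‖p - y‖ := hpos.trans_le hy
          rw [norm_div, norm_Kmap' hmap, norm_pow, Complex.norm_real, norm_norm, pow_two,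
            ← div_div, div_self hpos'.ne']
          gcongr)
        (fun t => φ (t / r i)) (hφC.comp (contDiff_id.div_const _))
        (by
          intro t ht
          have : t / r i ≤ a := by rw [div_le_iff₀ hri]; linarith
          simp [hφ, h0 _ this])
        (by
          intro t ht
          have : b ≤ t / r i := by rw [le_div_iff₀ hri]; linarith
          simp [hφ, h1 _ this])
        (by
          intro t
          have hda : HasDerivAt (fun t => φ (t / r i)) (deriv φ (t / r i) * (1 / r i)) t :=
            HasDerivAt.comp t ((hφC.differentiable (by norm_num)) _).hasDerivAt
              ((hasDerivAt_id t).div_const _)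
          rw [hda.deriv, abs_mul, abs_of_pos (show 0 < 1 / r i by positivity), mul_one_div]
          have := hD (t / r i)
          rw [Real.norm_eq_abs] at this
          gcongr)
        (by
          intro s hs
          exact hAe p hpA _ s (by positivity) hs.1 (by linarith [hs.2]))
      have e1 : ∀ y, φ (‖p - y‖ / r i) • (Kmap Ω (p - y) / ((‖p - y‖ : ℂ)) ^ 2)
          = (r i : ℂ)⁻¹ * ψ (zi - (y - x) / (r i : ℂ)) := by
        intro y
        rw [hzi']
        by_cases hy : p - y = 0
        · simp [hy, Kmap, hψ]
        have hny : (‖p - y‖ : ℂ) ≠ 0 := by exact_mod_cast norm_ne_zero_iff.2 hy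
        have hn : ‖(p - y) / (r i : ℂ)‖ = ‖p - y‖ / r i := by
          rw [norm_div, Complex.norm_real, Real.norm_of_nonneg hri.le]
        simp only [hψ, hφ, Kmap, hn, Complex.real_smul]
        have e2 : (p - y) / (r i : ℂ) / ((‖p - y‖ / r i : ℝ) : ℂ) = (p - y) / (‖p - y‖ : ℂ) := by
          push_cast; field_simp
        rw [e2]
        push_cast
        field_simp
      simp_rw [e1] at hb
      rw [integral_const_mul, norm_mul, norm_inv, Complex.norm_real,
        Real.norm_of_nonneg hri.le, inv_mul_le_iff₀ hri] at hb
      refine hb.trans (le_of_eq ?_)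
      field_simp
    -- comparison
    have hI1 : Integrable (fun y => ψ (z - (y - x) / (r i : ℂ))) μ :=
      integrable_scaled μ (fun w => ψ (z - w)) (by fun_prop)
        (hψcs.comp_homeomorph (Homeomorph.subLeft z)) x (r i) hri
    have hI2 : Integrable (fun y => ψ (zi - (y - x) / (r i : ℂ))) μ :=
      integrable_scaled μ (fun w => ψ (zi - w)) (by fun_prop)
        (hψcs.comp_homeomorph (Homeomorph.subLeft zi)) x (r i) hri
    have est2 : ‖∫ y, (ψ (z - (y - x) / (r i : ℂ)) - ψ (zi - (y - x) / (r i : ℂ))) ∂μ‖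
        ≤ e * μ.real (closedBall x ((‖z‖ + 1 + b) * r i)) := by
      rw [← setIntegral_eq_integral_of_forall_compl_eq_zero
        (s := closedBall x ((‖z‖ + 1 + b) * r i))]
      · apply norm_setIntegral_le_of_norm_le_const measure_closedBall_lt_top
        intro y _
        have := hdu (a := z - (y - x) / (r i : ℂ)) (b := zi - (y - x) / (r i : ℂ)) (by
          rw [dist_sub_right, dist_comm, dist_eq_norm]
          linarith)
        rw [dist_eq_norm] at this
        exact this.le
      · intro y hy
        have hy1 : (‖z‖ + 1 + b) * r i < ‖y - x‖ := by simpa [dist_eq_norm] using hy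
        have hy2 : ‖z‖ + 1 + b < ‖(y - x) / (r i : ℂ)‖ := by
          rw [norm_div, Complex.norm_real, Real.norm_of_nonneg hri.le, lt_div_iff₀ hri]
          exact hy1
        have t1 := norm_sub_norm_le ((y - x) / (r i : ℂ)) z
        have t2 := norm_sub_norm_le ((y - x) / (r i : ℂ)) zi
        have t3 := norm_sub_norm_le zi z
        rw [norm_sub_rev _ z] at t1
        rw [norm_sub_rev _ zi] at t2
        rw [hψ0 _ (by linarith), hψ0 _ (by linarith), sub_zero]
    rw [integral_sub hI1 hI2] at est2
    rw [norm_mul, Complex.norm_real, Real.norm_of_nonneg hci.le]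
    have est3 : ‖∫ y, ψ (z - (y - x) / (r i : ℂ)) ∂μ‖ ≤
        e * μ.real (closedBall x ((‖z‖ + 1 + b) * r i)) + r i * (e * D * (b - a)) := by
      have := norm_sub_norm_le (∫ y, ψ (z - (y - x) / (r i : ℂ)) ∂μ)
        (∫ y, ψ (zi - (y - x) / (r i : ℂ)) ∂μ)
      linarith
    have hba : 0 ≤ b - a := by linarith
    calc c i * ‖∫ y, ψ (z - (y - x) / (r i : ℂ)) ∂μ‖
        ≤ c i * (e * μ.real (closedBall x ((‖z‖ + 1 + b) * r i)) + r i * (e * D * (b - a))) := by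
          gcongr
      _ = e * (D * (b - a) * (c i * r i)
          + c i * μ.real (closedBall x ((‖z‖ + 1 + b) * r i))) := by ring
      _ ≤ e * (D * (b - a) * M₁ + M₂) := by gcongr
  have hfin : ‖∫ w, ψ (z - w) ∂ν‖ ≤ 0 := by
    have hT : Tendsto (fun e : ℝ => e * (D * (b - a) * M₁ + M₂)) (𝓝[>] 0) (𝓝 0) := by
      have : Continuous (fun e : ℝ => e * (D * (b - a) * M₁ + M₂)) := by fun_prop
      simpa using (this.tendsto 0).mono_left nhdsWithin_le_nhds
    refine ge_of_tendsto hT ?_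
    filter_upwards [self_mem_nhdsWithin] with e he using main e he
  exact norm_le_zero_iff.1 hfin

theorem main_ball {Ω : ℂ → ℂ} (hmap : MapsCircle Ω) (hK : Continuous (Kmap Ω))
    (ν : Measure ℂ) [IsLocallyFiniteMeasure ν] (z : ℂ)
    (hsm : ∀ (h : ℝ → ℝ) (a b : ℝ), ContDiff ℝ 1 h → 0 < a → a < b → (∀ t ≤ a, h t = 0) →
      (∀ t, b ≤ t → h t = 0) → ∫ w, h ‖z - w‖ • Kmap Ω (z - w) ∂ν = 0)
    (r : ℝ) (hr : 0 < r) : (∫ y in ball z r, Kmap Ω (z - y) ∂ν) = 0 := by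
  set h : ℕ → ℝ → ℝ := fun n t =>
    Real.smoothTransition (n * t - 1) * Real.smoothTransition (n * (r - t)) with hh
  have hC : ∀ n, ContDiff ℝ 1 (h n) := by
    intro n
    have hs : ContDiff ℝ 1 Real.smoothTransition := Real.smoothTransition.contDiff (n := 1)
    exact (hs.comp ((contDiff_const.mul contDiff_id).sub contDiff_const)).mul
      (hs.comp (contDiff_const.mul (contDiff_const.sub contDiff_id)))
  have hzero : ∀ n t, r ≤ t → h n t = 0 := by
    intro n t ht
    have : (n : ℝ) * (r - t) ≤ 0 := mul_nonpos_of_nonneg_of_nonpos (by positivity) (by linarith)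
    simp [hh, Real.smoothTransition.zero_of_nonpos this]
  have hle : ∀ n t, |h n t| ≤ 1 := by
    intro n t
    have a1 := Real.smoothTransition.nonneg (n * t - 1)
    have a2 := Real.smoothTransition.nonneg (n * (r - t))
    rw [abs_of_nonneg (mul_nonneg a1 a2)]
    exact mul_le_one₀ (Real.smoothTransition.le_one _) a2 (Real.smoothTransition.le_one _)
  have hev : ∀ᶠ n : ℕ in atTop, ∫ w, h n ‖z - w‖ • Kmap Ω (z - w) ∂ν = 0 := by
    filter_upwards [eventually_gt_atTop 0, tendsto_natCast_atTop_atTop.eventually_gt_atTop (1 / r)]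
      with n hn hn2
    have hn' : (0 : ℝ) < n := by exact_mod_cast hn
    refine hsm (h n) (1 / n) r (hC n) (by positivity) ?_ ?_ (hzero n)
    · rw [div_lt_iff₀ hr] at hn2
      rw [div_lt_iff₀ hn']; linarith
    · intro t ht
      rw [le_div_iff₀ hn'] at ht
      have : (n : ℝ) * t - 1 ≤ 0 := by linarith
      simp [hh, Real.smoothTransition.zero_of_nonpos this]
  have hlim : Tendsto (fun n => ∫ w, h n ‖z - w‖ • Kmap Ω (z - w) ∂ν) atTop
      (𝓝 (∫ w, (ball z r).indicator (fun w => Kmap Ω (z - w)) w ∂ν)) := by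
    apply tendsto_integral_of_dominated_convergence ((ball z r).indicator (fun _ => r))
    · intro n
      have : Continuous (h n) := (hC n).continuous
      exact Continuous.aestronglyMeasurable (by fun_prop)
    · exact (integrable_indicator_iff measurableSet_ball).2
        (integrableOn_const measure_ball_lt_top.ne)
    · intro n
      refine Eventually.of_forall fun w => ?_
      by_cases hw : w ∈ ball z r
      · rw [indicator_of_mem hw, norm_smul, norm_Kmap' hmap, Real.norm_eq_abs]
        have : ‖z - w‖ < r := by rw [norm_sub_rev]; simpa [dist_eq_norm] using hw
        have h2 := hle n ‖z - w‖
        nlinarith [norm_nonneg (z - w)]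
      · have : r ≤ ‖z - w‖ := by rw [norm_sub_rev]; simpa [dist_eq_norm] using hw
        rw [indicator_of_notMem hw, hzero n _ this, zero_smul, norm_zero]
    · refine Eventually.of_forall fun w => ?_
      by_cases hw : w ∈ ball z r
      · rw [indicator_of_mem hw]
        have hwr : ‖z - w‖ < r := by rw [norm_sub_rev]; simpa [dist_eq_norm] using hw
        by_cases hzw : z - w = 0
        · simp [hzw, Kmap]
        have hp : 0 < ‖z - w‖ := norm_pos_iff.2 hzw
        apply tendsto_const_nhds.congr'
        filter_upwards [tendsto_natCast_atTop_atTop.eventually_ge_atTop (2 / ‖z - w‖),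
          tendsto_natCast_atTop_atTop.eventually_ge_atTop (1 / (r - ‖z - w‖))] with n h1 h2
        rw [div_le_iff₀ hp] at h1
        rw [div_le_iff₀ (by linarith)] at h2
        simp only [hh]
        rw [Real.smoothTransition.one_of_one_le (by linarith),
          Real.smoothTransition.one_of_one_le h2]
        simp
      · have : r ≤ ‖z - w‖ := by rw [norm_sub_rev]; simpa [dist_eq_norm] using hw
        rw [indicator_of_notMem hw]
        simp only [hzero _ _ this, zero_smul]
        exact tendsto_const_nhds
  rw [integral_indicator measurableSet_ball] at hlim
  exact tendsto_nhds_unique hlim (tendsto_const_nhds.congr' (hev.mono fun n hn => hn.symm))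

theorem good_ae {Ω : ℂ → ℂ} (μ : Measure ℂ) [IsLocallyFiniteMeasure μ]
    (hpv : ∀ᵐ x ∂μ,
      (∀ ε : ℝ, 0 < ε →
        IntegrableOn (fun y => Kmap Ω (x - y) / ((‖x - y‖ : ℂ)) ^ 2) (ball x ε)ᶜ μ) ∧
      ∃ z : ℂ, Tendsto
        (fun ε : ℝ => ∫ y in (ball x ε)ᶜ, Kmap Ω (x - y) / ((‖x - y‖ : ℂ)) ^ 2 ∂μ)
        (𝓝[>] (0 : ℝ)) (𝓝 z)) : ∀ᵐ x ∂μ, GoodPt Ω μ x := by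
  set A : ℕ → ℕ → Set ℂ := fun k n => {p | ∀ a s : ℝ, 0 < a → a < s → s < 1 / ((n : ℝ) + 1) →
      ‖∫ y in ball p s \ ball p a, Kmap Ω (p - y) / ((‖p - y‖ : ℂ)) ^ 2 ∂μ‖ ≤ 1 / ((k : ℝ) + 1)}
    with hA
  have hd : ∀ᵐ x ∂μ, ∀ k n, x ∈ A k n →
      Tendsto (fun r => μ (A k n ∩ closedBall x r) / μ (closedBall x r)) (𝓝[>] 0) (𝓝 1) := by
    rw [ae_all_iff]; intro k
    rw [ae_all_iff]; intro n
    exact ae_imp_of_ae_restrict (Besicovitch.ae_tendsto_measure_inter_div μ (A k n))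
  filter_upwards [hd, hpv] with x hx hx2
  obtain ⟨hint, L, hL⟩ := hx2
  intro e he
  obtain ⟨k, hk⟩ := exists_nat_one_div_lt he
  have hk0 : (0 : ℝ) < 1 / ((k : ℝ) + 1) := by positivity
  have hev := (Metric.tendsto_nhds.1 hL) (1 / ((k : ℝ) + 1) / 2) (by positivity)
  rw [eventually_nhdsWithin_iff, Metric.eventually_nhds_iff] at hev
  obtain ⟨ρ, hρ, hev⟩ := hev
  obtain ⟨n, hn⟩ := exists_nat_one_div_lt hρ
  have hxA : x ∈ A k n := by
    intro a s ha has hs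
    have b1 := hev (y := a) (by rw [Real.dist_eq, sub_zero, abs_of_pos ha]; linarith) ha
    have b2 := hev (y := s) (by rw [Real.dist_eq, sub_zero, abs_of_pos (by linarith)]; linarith)
      (ha.trans has)
    have e1 : ball x s \ ball x a = (ball x a)ᶜ \ (ball x s)ᶜ := by
      ext y; simp [and_comm]
    rw [e1, setIntegral_sdiff (measurableSet_ball.compl) (hint a ha)
      (compl_subset_compl.2 (ball_subset_ball has.le)), ← dist_eq_norm]
    have := dist_triangle_right
      (∫ y in (ball x a)ᶜ, Kmap Ω (x - y) / ((‖x - y‖ : ℂ)) ^ 2 ∂μ)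
      (∫ y in (ball x s)ᶜ, Kmap Ω (x - y) / ((‖x - y‖ : ℂ)) ^ 2 ∂μ) L
    linarith
  refine ⟨A k n, 1 / ((n : ℝ) + 1), by positivity, hx k n hxA, ?_⟩
  intro p hp a s ha has hs
  exact (hp a s ha has hs).trans hk.le

theorem low_of_liminf (μ : Measure ℂ) [IsLocallyFiniteMeasure μ] (x : ℂ)
    (h : 0 < Filter.liminf (fun r : ℝ => μ (ball x r) / ENNReal.ofReal r) (𝓝[>] (0 : ℝ))) :
    ∃ q : ℝ, 0 < q ∧ ∀ᶠ t in 𝓝[>] (0 : ℝ), q * t ≤ μ.real (ball x t) := by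
  obtain ⟨q, hq0, hq⟩ := exists_between h
  have hqt : q ≠ ⊤ := (hq.trans_le le_top).ne
  refine ⟨q.toReal, ENNReal.toReal_pos hq0.ne' hqt, ?_⟩
  filter_upwards [eventually_lt_of_lt_liminf hq, self_mem_nhdsWithin] with t ht ht0
  have ht0 : 0 < t := ht0
  have h1 : q * ENNReal.ofReal t ≤ μ (ball x t) := ENNReal.mul_le_of_le_div ht.le
  have h2 := ENNReal.toReal_mono measure_ball_lt_top.ne h1
  rwa [ENNReal.toReal_mul, ENNReal.toReal_ofReal ht0.le] at h2

/-- Under positive lower / finite upper density and existence of the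
principal values μ-a.e., every tangent measure of μ is Ω-symmetric. -/
theorem stmt_11 (δ : ℝ) (hδ0 : 0 ≤ δ) (hδ1 : δ ≤ 1 / 20)
    (Ω : ℂ → ℂ) (hmap : MapsCircle Ω) (hodd : OddOnCircle Ω)
    (hbilip : BiLipOnCircle Ω δ) (hC2 : CircleCk Ω 2)
    (μ : Measure ℂ) [IsLocallyFiniteMeasure μ]
    (hdens : ∀ᵐ x ∂μ,
      0 < Filter.liminf (fun r : ℝ => μ (ball x r) / ENNReal.ofReal r) (𝓝[>] (0 : ℝ)) ∧
      Filter.limsup (fun r : ℝ => μ (ball x r) / ENNReal.ofReal r) (𝓝[>] (0 : ℝ)) < ⊤)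
    (hpv : ∀ᵐ x ∂μ,
      (∀ ε : ℝ, 0 < ε →
        IntegrableOn (fun y => Kmap Ω (x - y) / ((‖x - y‖ : ℂ)) ^ 2) (ball x ε)ᶜ μ) ∧
      ∃ z : ℂ, Tendsto
        (fun ε : ℝ => ∫ y in (ball x ε)ᶜ, Kmap Ω (x - y) / ((‖x - y‖ : ℂ)) ^ 2 ∂μ)
        (𝓝[>] (0 : ℝ)) (𝓝 z)) :
    ∀ᵐ x₀ ∂μ, ∀ ν : Measure ℂ, IsLocallyFiniteMeasure ν → IsTangentMeasure μ x₀ ν →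
      ∀ z ∈ spt ν, ∀ r : ℝ, 0 < r → (∫ y in ball z r, Kmap Ω (z - y) ∂ν) = 0 := by
  have hK := continuous_Kmap hmap hC2
  filter_upwards [hdens, good_ae μ hpv] with x hx hg
  rintro ν hν ⟨c, r, hc, hr, hr0, hconv⟩ z hz s hs
  refine main_ball hmap hK ν z ?_ s hs
  intro h a b hh ha hab h0 h1
  exact main_smooth hmap hK μ x ν c r hc hr hr0 hconv hg (low_of_liminf μ x hx.1) z hz h hh a b
    ha hab h0 h1
end
end

section
/- Suppose in addition that Ω is twice continuously differentiable. Let μ be a Radon measure on ℂ such that for μ-almost every x ∈ ℂ: (i) 0 < liminf_{r↓0} μ(B(x,r))/r and limsup_{r↓0} μ(B(x,r))/r < ∞; (ii) y ↦ K(x−y)/|x−y|² is μ-integrable on ℂ∖B(x,ε) for every ε > 0 and lim_{ε↓0} ∫_{ℂ∖B(x,ε)} K(x−y)/|x−y|² dμ(y) exists in ℂ. Then for μ-almost every x ∈ ℂ, every tangent measure ν ∈ Tan(μ, x) is Ω-symmetric at the origin: ∫_{B(0,r)} K(y) dν(y) = 0 for every r > 0. -/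
open MeasureTheory Metric Complex Filter Set
open scoped Topology ENNReal NNReal

noncomputable section

lemma aux_tele (t : ℕ → ℝ) (ht : Monotone t) (N : ℕ) (s : ℝ) :
    ∑ j ∈ Finset.range N, (Ico (t j) (t (j+1))).indicator (fun _ => (1:ℝ)) s
      = (Ico (t 0) (t N)).indicator (fun _ => (1:ℝ)) s := by
  induction N with
  | zero => simp
  | succ n ih =>
    rw [Finset.sum_range_succ, ih]
    have h1 := ht (Nat.zero_le n)
    have h2 := ht (Nat.le_succ n)
    simp only [Set.indicator_apply, Set.mem_Ico]
    simp only [Nat.succ_eq_add_one] at h2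
    split_ifs <;> first | (exfalso; grind) | norm_num

lemma aux_step (ψ : ℝ → ℝ) (hψ : Continuous ψ) (a b : ℝ) (hab : a < b)
    (h0 : ∀ s, s ∉ Ico a b → ψ s = 0) (η : ℝ) (hη : 0 < η) :
    ∃ (N : ℕ) (t : ℕ → ℝ), Monotone t ∧ t 0 = a ∧ t N = b ∧
      ∀ s, |ψ s - ∑ j ∈ Finset.range N,
          ψ (t j) * (Ico (t j) (t (j+1))).indicator (fun _ => (1:ℝ)) s|
        ≤ η * (Ico a b).indicator (fun _ => (1:ℝ)) s := by
  have huc := (isCompact_Icc (a := a) (b := b)).uniformContinuousOn_of_continuous hψ.continuousOn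
  rw [Metric.uniformContinuousOn_iff] at huc
  obtain ⟨d, hd, huc⟩ := huc η hη
  obtain ⟨n, hn⟩ := exists_nat_gt ((b - a) / d)
  have hba : 0 < b - a := by linarith
  have hn0 : (0:ℝ) < n := lt_trans (by positivity) hn
  have hmono : Monotone (fun j : ℕ => a + j * ((b - a) / n)) := by
    intro i j hij
    have : (i:ℝ) ≤ j := by exact_mod_cast hij
    dsimp only
    gcongr
  have hend : a + (n:ℝ) * ((b - a) / n) = b := by field_simp; ring
  refine ⟨n, fun j => a + j * ((b - a) / n), hmono, by simp, hend, ?_⟩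
  intro s
  have htele := aux_tele _ hmono n s
  simp only [hend, Nat.cast_zero, zero_mul, add_zero] at htele
  rw [← htele]
  have e1 : ψ s = ∑ j ∈ Finset.range n, ψ s *
      (Ico (a + j * ((b - a) / n)) (a + ((j+1 : ℕ):ℝ) * ((b - a) / n))).indicator
        (fun _ => (1:ℝ)) s := by
    rw [← Finset.mul_sum, htele]
    by_cases hs : s ∈ Ico a b
    · simp [hs]
    · simp [hs, h0 s hs]
  rw [e1, ← Finset.sum_sub_distrib, Finset.mul_sum]
  refine (Finset.abs_sum_le_sum_abs _ _).trans (Finset.sum_le_sum ?_)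
  intro j hj
  rw [← sub_mul]
  by_cases hs : s ∈ Ico (a + j * ((b - a) / n)) (a + ((j+1 : ℕ):ℝ) * ((b - a) / n))
  · simp only [hs, Set.indicator_of_mem, mul_one]
    have hj' : ((j+1:ℕ):ℝ) ≤ n := by exact_mod_cast Finset.mem_range.1 hj
    have hp : 0 < (b - a) / n := by positivity
    have hle : ((j+1:ℕ):ℝ) * ((b - a) / n) ≤ n * ((b - a) / n) := by gcongr
    have hjp : 0 ≤ (j:ℝ) * ((b - a) / n) := by positivity
    have hpd : (b - a) / n < d := by
      rw [div_lt_iff₀ hn0]; rw [div_lt_iff₀ hd] at hn; linarith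
    have := hs.1
    have h2 := hs.2
    push_cast at h2 hle
    have := huc s ⟨by linarith, by linarith⟩ (a + j * ((b - a) / n)) ⟨by linarith, by linarith⟩
      (by rw [Real.dist_eq, abs_lt]; constructor <;> linarith)
    rw [Real.dist_eq] at this
    exact this.le
  · rw [Set.indicator_of_notMem hs]; simp

lemma aux_annulus (μ : Measure ℂ) (x : ℂ) (k : ℂ → ℂ)
    (hKint : ∀ ε : ℝ, 0 < ε → IntegrableOn k (ball x ε)ᶜ μ) (u v : ℝ) (hu : 0 < u) (huv : u ≤ v) :
    ∫ y in ball x v \ ball x u, k y ∂μ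
      = (∫ y in (ball x u)ᶜ, k y ∂μ) - ∫ y in (ball x v)ᶜ, k y ∂μ := by
  rw [eq_sub_iff_add_eq, ← setIntegral_union]
  · congr 2
    ext y
    simp only [mem_union, Set.mem_sdiff, mem_ball, mem_compl_iff, not_lt]
    grind
  · rw [Set.disjoint_left]; rintro y ⟨h1, h2⟩ h3; exact h3 h1
  · exact measurableSet_ball.compl
  · exact (hKint u hu).mono_set (fun y hy => hy.2)
  · exact (hKint v (by linarith))

lemma aux_key (μ : Measure ℂ) [IsLocallyFiniteMeasure μ] (x : ℂ) (k : ℂ → ℂ)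
    (hk : ∀ y, ‖k y‖ ≤ ‖y - x‖⁻¹)
    (hKint : ∀ ε : ℝ, 0 < ε → IntegrableOn k (ball x ε)ᶜ μ) (z : ℂ)
    (hz : Tendsto (fun ε : ℝ => ∫ y in (ball x ε)ᶜ, k y ∂μ) (𝓝[>] (0 : ℝ)) (𝓝 z))
    (c r : ℕ → ℝ) (hc : ∀ i, 0 < c i) (hr : ∀ i, 0 < r i) (hr0 : Tendsto r atTop (𝓝 0))
    (hM : ∀ b : ℝ, 0 < b → ∃ M : ℝ, ∀ᶠ i in atTop, c i * μ.real (ball x (b * r i)) ≤ M)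
    (hC : ∃ C : ℝ, ∀ᶠ i in atTop, c i * r i ≤ C)
    (ψ : ℝ → ℝ) (hψ : Continuous ψ) (a b : ℝ) (ha : 0 < a) (hab : a < b)
    (h0 : ∀ s, s ∉ Ico a b → ψ s = 0) :
    Tendsto (fun i => ((c i * r i : ℝ) : ℂ) * ∫ y, (ψ (‖y - x‖ / r i) : ℂ) * k y ∂μ)
      atTop (𝓝 0) := by
  have hann : ∀ u v : ℝ, 0 < u → u ≤ v → Tendsto
      (fun i => ∫ y in ball x (v * r i) \ ball x (u * r i), k y ∂μ) atTop (𝓝 0) := by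
    intro u v hu huv
    have h1 : ∀ w : ℝ, 0 < w → Tendsto (fun i => ∫ y in (ball x (w * r i))ᶜ, k y ∂μ)
        atTop (𝓝 z) := by
      intro w hw
      refine hz.comp (f := fun i => w * r i) (tendsto_nhdsWithin_iff.2 ⟨?_, ?_⟩)
      · simpa using hr0.const_mul w
      · exact Eventually.of_forall fun i => mul_pos hw (hr i)
    have h2 := (h1 u hu).sub (h1 v (by linarith))
    rw [sub_self] at h2
    refine h2.congr fun i => ?_
    rw [aux_annulus μ x k hKint _ _ (mul_pos hu (hr i))]
    exact mul_le_mul_of_nonneg_right huv (hr i).le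
  obtain ⟨C, hC⟩ := hC
  obtain ⟨M, hM⟩ := hM b (by linarith)
  have hmemIco : ∀ (u v : ℝ) (i : ℕ) (y : ℂ), ‖y - x‖ / r i ∈ Ico u v ↔
      y ∈ ball x (v * r i) \ ball x (u * r i) := by
    intro u v i y
    rw [mem_Ico, le_div_iff₀ (hr i), div_lt_iff₀ (hr i), Set.mem_sdiff, mem_ball, mem_ball,
      dist_eq_norm, not_lt, and_comm]
  rw [Metric.tendsto_atTop']
  intro ε hε
  have hM1 : 0 < |M| + 1 := by positivity
  obtain ⟨N, t, htm, ht0, htN, hst⟩ := aux_step ψ hψ a b hab h0 (ε / 2 * a / (|M| + 1))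
    (by positivity)
  set η := ε / 2 * a / (|M| + 1) with hη
  have hηp : 0 < η := by positivity
  set S : ℕ → ℂ := fun i => ∑ j ∈ Finset.range N,
    (ψ (t j) : ℂ) * ∫ y in ball x (t (j+1) * r i) \ ball x (t j * r i), k y ∂μ with hS
  have htpos : ∀ j, 0 < t j := fun j => by
    have := htm (Nat.zero_le j); linarith
  have hS0 : Tendsto S atTop (𝓝 0) := by
    have : Tendsto S atTop (𝓝 (∑ j ∈ Finset.range N, (ψ (t j) : ℂ) * 0)) :=
      tendsto_finsetSum _ fun j _ =>
        (hann (t j) (t (j+1)) (htpos j) (htm (Nat.le_succ j))).const_mul _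
    simpa using this
  have hcS : Tendsto (fun i => C * ‖S i‖) atTop (𝓝 0) := by
    simpa using (hS0.norm).const_mul C
  have hev : ∀ᶠ i in atTop, C * ‖S i‖ < ε / 2 := hcS.eventually (gt_mem_nhds (by positivity))
  have hdiff : ∀ i, ‖(∫ y, (ψ (‖y - x‖ / r i) : ℂ) * k y ∂μ) - S i‖
      ≤ η * (a * r i)⁻¹ * μ.real (ball x (b * r i)) := by
    intro i
    have hA : ∀ u v : ℝ, MeasurableSet (ball x (v * r i) \ ball x (u * r i)) := fun u v =>
      measurableSet_ball.diff measurableSet_ball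
    have hkA : ∀ u v : ℝ, 0 < u → IntegrableOn k (ball x (v * r i) \ ball x (u * r i)) μ :=
      fun u v hu => (hKint (u * r i) (mul_pos hu (hr i))).mono_set fun y hy => hy.2
    have hSi : S i = ∫ y, ∑ j ∈ Finset.range N, (ψ (t j) : ℂ) *
        (ball x (t (j+1) * r i) \ ball x (t j * r i)).indicator k y ∂μ := by
      rw [integral_finsetSum]
      · refine Finset.sum_congr rfl fun j _ => ?_
        rw [integral_const_mul, integral_indicator (hA _ _)]
      · intro j _
        exact ((hkA _ _ (htpos j)).integrable_indicator (hA _ _)).const_mul _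
    have hSint : Integrable (fun y => ∑ j ∈ Finset.range N, (ψ (t j) : ℂ) *
        (ball x (t (j+1) * r i) \ ball x (t j * r i)).indicator k y) μ :=
      integrable_finsetSum _ fun j _ =>
        ((hkA _ _ (htpos j)).integrable_indicator (hA _ _)).const_mul _
    obtain ⟨B, hB⟩ : ∃ B, ∀ s, ‖ψ s‖ ≤ B := by
      obtain ⟨B, hB⟩ := (isCompact_Icc (a := a) (b := b)).exists_bound_of_continuousOn
        hψ.continuousOn
      refine ⟨max B 0, fun s => ?_⟩
      by_cases hs : s ∈ Ico a b
      · exact (hB s ⟨hs.1, hs.2.le⟩).trans (le_max_left _ _)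
      · simp [h0 s hs]
    have hψint : Integrable (fun y => (ψ (‖y - x‖ / r i) : ℂ) * k y) μ := by
      have e : (fun y => (ψ (‖y - x‖ / r i) : ℂ) * k y) = fun y => (ψ (‖y - x‖ / r i) : ℂ) *
          (ball x (b * r i) \ ball x (a * r i)).indicator k y := by
        funext y
        by_cases hy : ‖y - x‖ / r i ∈ Ico a b
        · rw [Set.indicator_of_mem ((hmemIco _ _ _ _).1 hy)]
        · rw [h0 _ hy]; simp
      rw [e]
      refine ((hkA a b ha).integrable_indicator (hA _ _)).bdd_mul (c := B) ?_ ?_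
      · refine Continuous.aestronglyMeasurable ?_
        fun_prop
      · refine Eventually.of_forall fun y => ?_
        simpa using hB (‖y - x‖ / r i)
    rw [hSi, ← integral_sub hψint hSint]
    have hbd : ∀ y, ‖(ψ (‖y - x‖ / r i) : ℂ) * k y - ∑ j ∈ Finset.range N, (ψ (t j) : ℂ) *
        (ball x (t (j+1) * r i) \ ball x (t j * r i)).indicator k y‖
        ≤ (ball x (b * r i)).indicator (fun _ => η * (a * r i)⁻¹) y := by
      intro y
      have e : (ψ (‖y - x‖ / r i) : ℂ) * k y - ∑ j ∈ Finset.range N, (ψ (t j) : ℂ) *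
          (ball x (t (j+1) * r i) \ ball x (t j * r i)).indicator k y
          = ((ψ (‖y - x‖ / r i) - ∑ j ∈ Finset.range N,
          ψ (t j) * (Ico (t j) (t (j+1))).indicator (fun _ => (1:ℝ)) (‖y - x‖ / r i) : ℝ) : ℂ)
            * k y := by
        push_cast
        rw [sub_mul, Finset.sum_mul]
        congr 1
        refine Finset.sum_congr rfl fun j _ => ?_
        by_cases hy : ‖y - x‖ / r i ∈ Ico (t j) (t (j+1))
        · rw [Set.indicator_of_mem ((hmemIco _ _ _ _).1 hy), Set.indicator_of_mem hy]; simp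
        · rw [Set.indicator_of_notMem (fun h => hy ((hmemIco _ _ _ _).2 h)),
            Set.indicator_of_notMem hy]; simp
      rw [e, norm_mul, Complex.norm_real, Real.norm_eq_abs]
      have h1 := hst (‖y - x‖ / r i)
      by_cases hy : ‖y - x‖ / r i ∈ Ico a b
      · rw [Set.indicator_of_mem hy, mul_one] at h1
        have hy' := (hmemIco _ _ _ _).1 hy
        rw [Set.indicator_of_mem hy'.1]
        have h2 : ‖k y‖ ≤ (a * r i)⁻¹ := by
          refine (hk y).trans ?_
          have := hy.1
          rw [le_div_iff₀ (hr i)] at this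
          have := mul_pos ha (hr i)
          gcongr
        exact mul_le_mul h1 h2 (norm_nonneg _) hηp.le
      · rw [Set.indicator_of_notMem hy, mul_zero] at h1
        have h3 := le_antisymm h1 (abs_nonneg _)
        rw [h3, zero_mul]
        refine Set.indicator_nonneg (fun _ _ => ?_) _
        have := hr i
        positivity
    refine (norm_integral_le_of_norm_le ?_ (Eventually.of_forall hbd)).trans ?_
    · refine (integrable_indicator_iff measurableSet_ball).2 ?_
      refine integrableOn_const (measure_ball_lt_top.ne)
    · rw [integral_indicator measurableSet_ball, setIntegral_const, smul_eq_mul, mul_comm]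
  have hall := (hM.and hC).and hev
  obtain ⟨i0, hi0⟩ := eventually_atTop.1 hall
  refine ⟨i0, fun i hi => ?_⟩
  obtain ⟨⟨hMi, hCi⟩, hei⟩ := hi0 i hi.le
  rw [dist_zero_right, norm_mul, Complex.norm_real, Real.norm_eq_abs]
  have hci := hc i
  have hri := hr i
  rw [abs_of_pos (by positivity)]
  set I := ∫ y, (ψ (‖y - x‖ / r i) : ℂ) * k y ∂μ
  have hI : ‖I‖ ≤ ‖I - S i‖ + ‖S i‖ := by
    simpa using norm_add_le (I - S i) (S i)
  have h1 : c i * r i * ‖I - S i‖ ≤ ε / 2 := by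
    calc c i * r i * ‖I - S i‖
        ≤ c i * r i * (η * (a * r i)⁻¹ * μ.real (ball x (b * r i))) := by
          gcongr; exact hdiff i
      _ = η / a * (c i * μ.real (ball x (b * r i))) := by field_simp
      _ ≤ η / a * (|M| + 1) := by
          gcongr
          linarith [le_abs_self M]
      _ = ε / 2 := by rw [hη]; field_simp
  have h2 : c i * r i * ‖S i‖ ≤ C * ‖S i‖ := by gcongr
  have h3 : c i * r i * ‖I‖ ≤ c i * r i * (‖I - S i‖ + ‖S i‖) := by gcongr
  linarith

lemma aux_unit_s12 (y : ℂ) (hy : y ≠ 0) : ‖y / (‖y‖ : ℂ)‖ = 1 := by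
  have : ‖y‖ ≠ 0 := norm_ne_zero_iff.2 hy
  rw [norm_div, Complex.norm_real, norm_norm, div_self this]

lemma aux_Knorm (Ω : ℂ → ℂ) (hmap : MapsCircle Ω) (y : ℂ) : ‖Kmap Ω y‖ = ‖y‖ := by
  by_cases hy : y = 0
  · simp [Kmap, hy]
  · rw [Kmap, norm_mul, hmap _ (aux_unit_s12 y hy)]; simp

lemma aux_Kodd (Ω : ℂ → ℂ) (hodd : OddOnCircle Ω) (y : ℂ) : Kmap Ω (-y) = -Kmap Ω y := by
  by_cases hy : y = 0
  · simp [Kmap, hy]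
  · rw [Kmap, norm_neg, neg_div, hodd _ (aux_unit_s12 y hy), Kmap]; ring

lemma aux_Khom (Ω : ℂ → ℂ) (y : ℂ) (r : ℝ) (hr : 0 < r) :
    Kmap Ω (y / (r : ℂ)) = Kmap Ω y / (r : ℂ) := by
  have hr' : (r : ℂ) ≠ 0 := by exact_mod_cast hr.ne'
  have hn : ‖y / (r : ℂ)‖ = ‖y‖ / r := by
    rw [norm_div, Complex.norm_real, Real.norm_eq_abs, abs_of_pos hr]
  rw [Kmap, hn, Kmap]
  push_cast
  rw [div_div_div_cancel_right₀ hr']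
  ring

lemma aux_normsq (u v : ℂ) (hu : ‖u‖ = 1) (hv : ‖v‖ = 1) :
    ‖u - v‖ ^ 2 = 2 - 2 * rinner u v := by
  have h1 : u.re * u.re + u.im * u.im = 1 := by
    rw [← Complex.normSq_apply, Complex.normSq_eq_norm_sq, hu]; norm_num
  have h2 : v.re * v.re + v.im * v.im = 1 := by
    rw [← Complex.normSq_apply, Complex.normSq_eq_norm_sq, hv]; norm_num
  rw [← Complex.normSq_eq_norm_sq, Complex.normSq_apply, rinner]
  simp only [Complex.sub_re, Complex.sub_im]
  linarith

lemma aux_rinner_mem (u v : ℂ) (hu : ‖u‖ = 1) (hv : ‖v‖ = 1) :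
    -1 ≤ rinner u v ∧ rinner u v ≤ 1 := by
  have h1 := aux_normsq u v hu hv
  have h2 : ‖u - v‖ ≤ 2 := by
    have := norm_sub_le u v; linarith
  have h3 := norm_nonneg (u - v)
  constructor <;> nlinarith

lemma aux_Ωcont (Ω : ℂ → ℂ) (δ : ℝ) (hmap : MapsCircle Ω)
    (hbilip : BiLipOnCircle Ω δ) : ContinuousOn Ω (sphere 0 1) := by
  intro v hv
  have hv1 : ‖v‖ = 1 := by simpa using hv
  have hvv : rinner v v = 1 := by
    have := aux_normsq v v hv1 hv1
    simp at this; linarith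
  have h1 : Tendsto (fun u => (1 + δ) * dS u v) (𝓝[sphere 0 1] v) (𝓝 0) := by
    have hc : Continuous fun u => (1 + δ) * dS u v := by
      unfold dS rinner
      have := Real.continuous_arccos
      fun_prop
    have := hc.tendsto v
    simp only [dS, hvv, Real.arccos_one, mul_zero] at this
    exact this.mono_left nhdsWithin_le_nhds
  have h2 : Tendsto (fun u => dS (Ω u) (Ω v)) (𝓝[sphere 0 1] v) (𝓝 0) := by
    refine tendsto_of_tendsto_of_tendsto_of_le_of_le' tendsto_const_nhds h1 ?_ ?_
    · exact Eventually.of_forall fun u => Real.arccos_nonneg _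
    · filter_upwards [self_mem_nhdsWithin] with u hu
      exact (hbilip u v (by simpa using hu) hv1).2
  have h3 : Tendsto (fun u => Real.sqrt (2 - 2 * Real.cos (dS (Ω u) (Ω v))))
      (𝓝[sphere 0 1] v) (𝓝 0) := by
    have hc : Continuous fun s => Real.sqrt (2 - 2 * Real.cos s) := by fun_prop
    have := (hc.tendsto 0).comp h2
    simpa [Function.comp_def] using this
  rw [ContinuousWithinAt, tendsto_iff_norm_sub_tendsto_zero]
  refine h3.congr' ?_
  filter_upwards [self_mem_nhdsWithin] with u hu
  have hu1 : ‖u‖ = 1 := by simpa using hu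
  have hm := aux_rinner_mem _ _ (hmap u hu1) (hmap v hv1)
  rw [dS, Real.cos_arccos hm.1 hm.2, ← aux_normsq _ _ (hmap u hu1) (hmap v hv1),
    Real.sqrt_sq (norm_nonneg _)]

lemma aux_Kcont (Ω : ℂ → ℂ) (δ : ℝ) (hmap : MapsCircle Ω)
    (hbilip : BiLipOnCircle Ω δ) : Continuous (Kmap Ω) := by
  have hΩ := aux_Ωcont Ω δ hmap hbilip
  rw [continuous_iff_continuousAt]
  intro y
  by_cases hy : y = 0
  · subst hy
    have h0 : Kmap Ω 0 = 0 := by simp [Kmap]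
    rw [ContinuousAt, h0, tendsto_zero_iff_norm_tendsto_zero]
    simp only [aux_Knorm Ω hmap]
    simpa using (continuous_norm (E := ℂ)).tendsto 0
  · have hn : (‖y‖ : ℂ) ≠ 0 := by exact_mod_cast norm_ne_zero_iff.2 hy
    have hq : ContinuousAt (fun u : ℂ => u / (‖u‖ : ℂ)) y := by
      refine continuousAt_id.div ?_ hn
      exact (Complex.continuous_ofReal.comp continuous_norm).continuousAt
    refine ContinuousAt.mul (Complex.continuous_ofReal.comp continuous_norm).continuousAt ?_
    have h1 := hΩ (y / (‖y‖ : ℂ)) (by simpa using aux_unit_s12 y hy)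
    refine Tendsto.comp h1 (tendsto_nhdsWithin_iff.2 ⟨hq, ?_⟩)
    filter_upwards [isOpen_ne.mem_nhds hy] with u hu
    simpa using aux_unit_s12 u hu

lemma aux_bdd (μ : Measure ℂ) [IsLocallyFiniteMeasure μ] (x : ℂ) (ν : Measure ℂ)
    (c r : ℕ → ℝ) (hc : ∀ i, 0 < c i) (hr : ∀ i, 0 < r i)
    (hT : ∀ f : ℂ → ℝ, Continuous f → HasCompactSupport f →
      Tendsto (fun i => c i * ∫ y, f ((y - x) / ((r i : ℝ) : ℂ)) ∂μ) atTop
        (𝓝 (∫ y, f y ∂ν))) (b : ℝ) :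
    ∃ M : ℝ, ∀ᶠ i in atTop, c i * μ.real (ball x (b * r i)) ≤ M := by
  set f : ℂ → ℝ := fun y => max 0 (min 1 (b + 1 - ‖y‖)) with hf
  have hfc : Continuous f := by fun_prop
  have hfs : HasCompactSupport f := by
    refine HasCompactSupport.intro (isCompact_closedBall (0:ℂ) (b + 1)) fun y hy => ?_
    simp only [mem_closedBall, dist_zero_right, not_le] at hy
    exact max_eq_left ((min_le_right _ _).trans (by linarith))
  have h1 := hT f hfc hfs
  refine ⟨(∫ y, f y ∂ν) + 1, ?_⟩
  filter_upwards [h1.eventually (gt_mem_nhds (lt_add_one _))] with i hi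
  refine le_trans ?_ hi.le
  have hri := hr i
  have hci := hc i
  gcongr
  have hg : Continuous fun y => f ((y - x) / ((r i : ℝ) : ℂ)) :=
    hfc.comp (by fun_prop)
  have hnorm : ∀ y, ‖(y - x) / ((r i : ℝ) : ℂ)‖ = ‖y - x‖ / r i := fun y => by
    rw [norm_div, Complex.norm_real, Real.norm_eq_abs, abs_of_pos hri]
  have hgs : HasCompactSupport fun y => f ((y - x) / ((r i : ℝ) : ℂ)) := by
    refine HasCompactSupport.intro (isCompact_closedBall x ((b + 1) * r i)) fun y hy => ?_
    simp only [mem_closedBall, dist_eq_norm, not_le] at hy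
    have : b + 1 < ‖y - x‖ / r i := by rwa [lt_div_iff₀ hri]
    simp only [hf, hnorm]
    exact max_eq_left ((min_le_right _ _).trans (by linarith))
  have e : μ.real (ball x (b * r i)) = ∫ y, (ball x (b * r i)).indicator (fun _ => (1:ℝ)) y ∂μ := by
    rw [integral_indicator measurableSet_ball, setIntegral_const]; simp
  rw [e]
  refine integral_mono ?_ (hg.integrable_of_hasCompactSupport hgs) ?_
  · exact (integrable_indicator_iff measurableSet_ball).2
      (integrableOn_const (measure_ball_lt_top.ne))
  · intro y
    by_cases hy : y ∈ ball x (b * r i)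
    · rw [Set.indicator_of_mem hy]
      have : ‖y - x‖ / r i < b := by
        rw [div_lt_iff₀ hri]; simpa [dist_eq_norm] using hy
      simp only [hf, hnorm]
      exact le_max_of_le_right (le_min le_rfl (by linarith))
    · rw [Set.indicator_of_notMem hy]
      exact le_max_left _ _

lemma aux_dens (μ : Measure ℂ) [IsLocallyFiniteMeasure μ] (x : ℂ)
    (h : 0 < Filter.liminf (fun r : ℝ => μ (ball x r) / ENNReal.ofReal r) (𝓝[>] (0 : ℝ))) :
    ∃ m : ℝ, 0 < m ∧ ∀ᶠ r in 𝓝[>] (0:ℝ), m * r ≤ μ.real (ball x r) := by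
  obtain ⟨m, hm0, hm⟩ := exists_between h
  have hmt : m ≠ ⊤ := (lt_top_of_lt hm).ne
  refine ⟨m.toReal, ENNReal.toReal_pos hm0.ne' hmt, ?_⟩
  filter_upwards [Filter.eventually_lt_of_lt_liminf hm, self_mem_nhdsWithin] with r h1 hr
  have hr' : (0:ℝ) < r := hr
  have h2 := ENNReal.mul_le_of_le_div h1.le
  have h3 := ENNReal.toReal_mono (measure_ball_lt_top (μ := μ) (x := x) (r := r)).ne h2
  rwa [ENNReal.toReal_mul, ENNReal.toReal_ofReal hr'.le] at h3

lemma aux_test (Ω : ℂ → ℂ) (δ : ℝ) (hmap : MapsCircle Ω) (hodd : OddOnCircle Ω)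
    (hbilip : BiLipOnCircle Ω δ) (μ : Measure ℂ) [IsLocallyFiniteMeasure μ] (x : ℂ)
    (hd : 0 < Filter.liminf (fun r : ℝ => μ (ball x r) / ENNReal.ofReal r) (𝓝[>] (0 : ℝ)))
    (hKint : ∀ ε : ℝ, 0 < ε →
        IntegrableOn (fun y => Kmap Ω (x - y) / ((‖x - y‖ : ℂ)) ^ 2) (ball x ε)ᶜ μ)
    (z : ℂ) (hz : Tendsto
        (fun ε : ℝ => ∫ y in (ball x ε)ᶜ, Kmap Ω (x - y) / ((‖x - y‖ : ℂ)) ^ 2 ∂μ)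
        (𝓝[>] (0 : ℝ)) (𝓝 z))
    (ν : Measure ℂ) [IsLocallyFiniteMeasure ν] (hν : IsTangentMeasure μ x ν)
    (g : ℝ → ℝ) (hg : Continuous g) (a b : ℝ) (ha : 0 < a) (hab : a < b)
    (h0 : ∀ s, s ∉ Ico a b → g s = 0) :
    ∫ y, (g ‖y‖ : ℂ) * Kmap Ω y ∂ν = 0 := by
  obtain ⟨c, r, hc, hr, hr0, hT⟩ := hν
  have hK := aux_Kcont Ω δ hmap hbilip
  have hM := aux_bdd μ x ν c r hc hr hT
  have hC : ∃ C : ℝ, ∀ᶠ i in atTop, c i * r i ≤ C := by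
    obtain ⟨m, hm, hm'⟩ := aux_dens μ x hd
    obtain ⟨M, hM⟩ := hM 1
    have hr0' : Tendsto r atTop (𝓝[>] 0) :=
      tendsto_nhdsWithin_iff.2 ⟨hr0, Eventually.of_forall hr⟩
    refine ⟨M / m, ?_⟩
    filter_upwards [hM, hr0'.eventually hm'] with i h1 h2
    rw [one_mul] at h1
    rw [le_div_iff₀ hm]
    have := mul_le_mul_of_nonneg_left h2 (hc i).le
    linarith
  have hkey := aux_key μ x (fun y => Kmap Ω (x - y) / ((‖x - y‖ : ℂ)) ^ 2) (by
      intro y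
      rw [norm_div, aux_Knorm Ω hmap, norm_pow, Complex.norm_real, norm_norm, norm_sub_rev y x]
      by_cases hy : ‖x - y‖ = 0
      · simp [hy]
      · apply le_of_eq; field_simp) hKint z hz c r hc hr hr0 (fun b _ => hM b) hC
    (fun s => g s * s ^ 2) (by fun_prop) a b ha hab (fun s hs => by simp [h0 s hs])
  set F : ℂ → ℂ := fun y => (g ‖y‖ : ℂ) * Kmap Ω y with hF
  have hFc : Continuous F := by fun_prop
  have hF0 : ∀ y, b < ‖y‖ → F y = 0 := fun y hy => by
    have : g ‖y‖ = 0 := h0 _ (fun h => by have := h.2; linarith)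
    simp [hF, this]
  have hFs : HasCompactSupport F := by
    refine HasCompactSupport.intro (isCompact_closedBall (0:ℂ) b) fun y hy => ?_
    simp only [mem_closedBall, dist_zero_right, not_le] at hy
    exact hF0 y hy
  have hFi : Integrable F ν := hFc.integrable_of_hasCompactSupport hFs
  have hscale : ∀ i y, F ((y - x) / ((r i : ℝ) : ℂ)) = -(r i : ℂ) *
      (((g (‖y - x‖ / r i) * (‖y - x‖ / r i) ^ 2 : ℝ) : ℂ) *
        (Kmap Ω (x - y) / ((‖x - y‖ : ℂ)) ^ 2)) := by
    intro i y
    have hri : (r i : ℂ) ≠ 0 := by exact_mod_cast (hr i).ne'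
    have hn : ‖(y - x) / ((r i : ℝ) : ℂ)‖ = ‖y - x‖ / r i := by
      rw [norm_div, Complex.norm_real, Real.norm_eq_abs, abs_of_pos (hr i)]
    simp only [hF]
    rw [hn, aux_Khom Ω _ _ (hr i), ← neg_sub x y, aux_Kodd Ω hodd, norm_neg]
    by_cases hy : x - y = 0
    · simp [hy, Kmap]
    · have hnn : (‖x - y‖ : ℂ) ≠ 0 := by exact_mod_cast norm_ne_zero_iff.2 hy
      push_cast
      field_simp
  have hFint : ∀ i, Integrable (fun y => F ((y - x) / ((r i : ℝ) : ℂ))) μ := by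
    intro i
    refine Continuous.integrable_of_hasCompactSupport (hFc.comp (by fun_prop)) ?_
    refine HasCompactSupport.intro (isCompact_closedBall x (b * r i)) fun y hy => ?_
    simp only [mem_closedBall, dist_eq_norm, not_le] at hy
    apply hF0
    rwa [norm_div, Complex.norm_real, Real.norm_eq_abs, abs_of_pos (hr i), lt_div_iff₀ (hr i)]
  have hlim : Tendsto (fun i => (c i : ℂ) * ∫ y, F ((y - x) / ((r i : ℝ) : ℂ)) ∂μ) atTop
      (𝓝 0) := by
    have := hkey.neg
    rw [neg_zero] at this
    refine this.congr fun i => ?_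
    simp only [hscale]
    rw [integral_const_mul]
    push_cast
    ring
  have hre := hT (fun y => (F y).re) (Complex.continuous_re.comp hFc)
    (hFs.comp_left (g := Complex.re) rfl)
  have him := hT (fun y => (F y).im) (Complex.continuous_im.comp hFc)
    (hFs.comp_left (g := Complex.im) rfl)
  have hre' := (Complex.continuous_re.tendsto 0).comp hlim
  have him' := (Complex.continuous_im.tendsto 0).comp hlim
  have e1 : ∫ y, (F y).re ∂ν = 0 := by
    refine tendsto_nhds_unique hre (hre'.congr fun i => ?_)
    simp only [Function.comp, Complex.re_ofReal_mul]
    rw [← RCLike.re_eq_complex_re, ← integral_re (hFint i)]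
  have e2 : ∫ y, (F y).im ∂ν = 0 := by
    refine tendsto_nhds_unique him (him'.congr fun i => ?_)
    simp only [Function.comp, Complex.im_ofReal_mul]
    rw [← RCLike.im_eq_complex_im, ← integral_im (hFint i)]
  apply Complex.ext
  · rw [← RCLike.re_eq_complex_re, ← integral_re hFi]; exact e1
  · rw [← RCLike.im_eq_complex_im, ← integral_im hFi]; exact e2

/-- Under positive lower / finite upper density and existence of the
principal values μ-a.e., every tangent measure of μ is Ω-symmetric at the origin. -/
theorem stmt_12 (δ : ℝ) (hδ0 : 0 ≤ δ) (hδ1 : δ ≤ 1 / 20)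
    (Ω : ℂ → ℂ) (hmap : MapsCircle Ω) (hodd : OddOnCircle Ω)
    (hbilip : BiLipOnCircle Ω δ) (hC2 : CircleCk Ω 2)
    (μ : Measure ℂ) [IsLocallyFiniteMeasure μ]
    (hdens : ∀ᵐ x ∂μ,
      0 < Filter.liminf (fun r : ℝ => μ (ball x r) / ENNReal.ofReal r) (𝓝[>] (0 : ℝ)) ∧
      Filter.limsup (fun r : ℝ => μ (ball x r) / ENNReal.ofReal r) (𝓝[>] (0 : ℝ)) < ⊤)
    (hpv : ∀ᵐ x ∂μ,
      (∀ ε : ℝ, 0 < ε →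
        IntegrableOn (fun y => Kmap Ω (x - y) / ((‖x - y‖ : ℂ)) ^ 2) (ball x ε)ᶜ μ) ∧
      ∃ z : ℂ, Tendsto
        (fun ε : ℝ => ∫ y in (ball x ε)ᶜ, Kmap Ω (x - y) / ((‖x - y‖ : ℂ)) ^ 2 ∂μ)
        (𝓝[>] (0 : ℝ)) (𝓝 z)) :
    ∀ᵐ x ∂μ, ∀ ν : Measure ℂ, IsLocallyFiniteMeasure ν → IsTangentMeasure μ x ν →
      ∀ r : ℝ, 0 < r → (∫ y in ball (0 : ℂ) r, Kmap Ω y ∂ν) = 0 := by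
  filter_upwards [hdens, hpv] with x hd hp ν hνf hν R hR
  obtain ⟨hKint, z, hz⟩ := hp
  have hK := aux_Kcont Ω δ hmap hbilip
  set g : ℕ → ℝ → ℝ := fun n s => max 0 (min 1 (min ((n:ℝ) * s - 1) (n * (R - s)))) with hgdef
  have hg0 : ∀ n s, R ≤ s → g n s = 0 := fun n s hs => by
    refine max_eq_left ((min_le_right _ _).trans ((min_le_right _ _).trans ?_))
    exact mul_nonpos_of_nonneg_of_nonpos (by positivity) (by linarith)
  have hg1 : ∀ n s, |g n s| ≤ 1 := fun n s => by
    rw [abs_of_nonneg (le_max_left _ _)]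
    exact max_le zero_le_one (min_le_left _ _)
  have hzero : ∀ᶠ n in atTop, ∫ y, (g n ‖y‖ : ℂ) * Kmap Ω y ∂ν = 0 := by
    obtain ⟨n0, hn0⟩ := exists_nat_gt (1 / R)
    filter_upwards [eventually_ge_atTop n0] with n hn
    have hnR : 1 / R < n := hn0.trans_le (by exact_mod_cast hn)
    have hnp : (0:ℝ) < n := lt_trans (by positivity) hnR
    refine aux_test Ω δ hmap hodd hbilip μ x hd.1 hKint z hz ν hν (g n) (by fun_prop) (1 / n) R
      (by positivity) ?_ ?_
    · rw [div_lt_iff₀ hnp]; rw [div_lt_iff₀ hR] at hnR; linarith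
    · intro s hs
      by_cases hs1 : R ≤ s
      · exact hg0 n s hs1
      · have : s < 1 / n := by
          by_contra h
          exact hs ⟨not_lt.1 h, not_le.1 hs1⟩
        rw [lt_div_iff₀ hnp] at this
        refine max_eq_left ((min_le_right _ _).trans ((min_le_left _ _).trans ?_))
        linarith
  have hlim : Tendsto (fun n => ∫ y, (g n ‖y‖ : ℂ) * Kmap Ω y ∂ν) atTop
      (𝓝 (∫ y, (ball (0:ℂ) R).indicator (Kmap Ω) y ∂ν)) := by
    refine tendsto_integral_of_dominated_convergence
      ((ball (0:ℂ) R).indicator fun _ => R) ?_ ?_ ?_ ?_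
    · intro n
      exact Continuous.aestronglyMeasurable (by fun_prop)
    · exact (integrable_indicator_iff measurableSet_ball).2
        (integrableOn_const (measure_ball_lt_top.ne))
    · intro n
      refine Eventually.of_forall fun y => ?_
      rw [norm_mul, Complex.norm_real, Real.norm_eq_abs, aux_Knorm Ω hmap]
      by_cases hy : y ∈ ball (0:ℂ) R
      · rw [Set.indicator_of_mem hy]
        have : ‖y‖ < R := by simpa using hy
        have := hg1 n ‖y‖
        nlinarith [norm_nonneg y]
      · rw [Set.indicator_of_notMem hy]
        have : R ≤ ‖y‖ := by simpa using hy
        rw [hg0 n _ this]; simp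
    · refine Eventually.of_forall fun y => ?_
      by_cases hy : y ∈ ball (0:ℂ) R
      · rw [Set.indicator_of_mem hy]
        have hyR : ‖y‖ < R := by simpa using hy
        by_cases hy0 : y = 0
        · subst hy0
          simp [Kmap]
        · have hyp : 0 < ‖y‖ := norm_pos_iff.2 hy0
          refine tendsto_const_nhds.congr' ?_
          obtain ⟨n1, hn1⟩ := exists_nat_gt (2 / ‖y‖)
          obtain ⟨n2, hn2⟩ := exists_nat_gt (1 / (R - ‖y‖))
          have hRy : 0 < R - ‖y‖ := by linarith
          filter_upwards [eventually_ge_atTop n1, eventually_ge_atTop n2] with n h1 h2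
          have h1' : 2 / ‖y‖ < n := hn1.trans_le (by exact_mod_cast h1)
          have h2' : 1 / (R - ‖y‖) < n := hn2.trans_le (by exact_mod_cast h2)
          rw [div_lt_iff₀ hyp] at h1'
          rw [div_lt_iff₀ hRy] at h2'
          have : g n ‖y‖ = 1 := by
            simp only [hgdef]
            rw [min_eq_left (le_min (by linarith) (by linarith)), max_eq_right zero_le_one]
          simp [this]
      · rw [Set.indicator_of_notMem hy]
        have : R ≤ ‖y‖ := by simpa using hy
        simp [hg0 _ _ this]
  rw [← integral_indicator measurableSet_ball]
  refine tendsto_nhds_unique hlim (tendsto_const_nhds.congr' ?_)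
  filter_upwards [hzero] with n hn using hn.symm
end
end
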